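/- Let X be a ℤ²-subshift whose set of nonexpansive rays is finite and nonempty, and assume each nonexpansive ray of X is rational and closing. Then there exist a recoding Y of X and a convex integer polygon P (possibly degenerate, i.e. a line segment, which occurs exactly when X has precisely two nonexpansive rays) such that P is a coding polygon for Y, every oriented edge of P is positively parallel to a nonexpansive ray of X, and every nonexpansive ray of X is positively parallel to an oriented edge of P. -/

import Mathlib

namespace PolygonalShifts

abbrev Z2 : Type := ℤ × ℤ

abbrev Config (A : Type*) : Type _ := Z2 → A

/-- The translation action of `ℤ²` on configurations. -/
def shiftAct {A : Type*} (u : Z2) (x : Config A) : Config A := fun w => x (u + w)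

/-- A `ℤ²`-subshift: a closed (for the product topology, with the alphabet discrete)
and translation-invariant set of configurations. -/
def IsSubshift {A : Type*} (X : Set (Config A)) : Prop :=
  (letI : TopologicalSpace A := ⊥
   IsClosed X) ∧
  ∀ u : Z2, ∀ x ∈ X, shiftAct u x ∈ X

/-- The canonical embedding `ℤ² → ℝ²`. -/
def toR2 (p : Z2) : ℝ × ℝ := ((p.1 : ℝ), (p.2 : ℝ))

/-- `S` X-codes `S'`, for subsets `S, S'` of `ℝ²`. -/
def Codes {A : Type*} (X : Set (Config A)) (S S' : Set (ℝ × ℝ)) : Prop :=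
  ∀ x ∈ X, ∀ x' ∈ X,
    (∀ p : Z2, toR2 p ∈ S → x p = x' p) →
    ∀ p : Z2, toR2 p ∈ S' → x p = x' p

/-- `S` X-codes `S'`, for subsets `S, S'` of `ℤ²`. -/
def CodesZ {A : Type*} (X : Set (Config A)) (S S' : Set Z2) : Prop :=
  ∀ x ∈ X, ∀ x' ∈ X, (∀ p ∈ S, x p = x' p) → ∀ p ∈ S', x p = x' p

/-- `Y` is a recoding of `X` via the finite set `F ⊆ ℤ²`. -/
def IsRecodingVia {A A' : Type*} (X : Set (Config A)) (Y : Set (Config A'))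
    (F : Set Z2) : Prop :=
  letI : TopologicalSpace A := ⊥
  letI : TopologicalSpace A' := ⊥
  ∃ Ψ : X ≃ₜ Y,
    (∀ (u : Z2) (x x' : X), (x' : Config A) = shiftAct u (x : Config A) →
      (↑(Ψ x') : Config A') = shiftAct u (↑(Ψ x) : Config A')) ∧
    (∀ (u : Z2) (x x' : X),
      (↑(Ψ x) : Config A') u = (↑(Ψ x') : Config A') u ↔
        ∀ f ∈ F, (x : Config A) (f + u) = (x' : Config A) (f + u))

/-- `Y` is a recoding of `X`. -/
def IsRecoding {A A' : Type*} (X : Set (Config A)) (Y : Set (Config A')) : Prop :=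
  ∃ F : Set Z2, F.Finite ∧ IsRecodingVia X Y F

/-- Integer cross product. -/
def crossZ (u v : Z2) : ℤ := u.1 * v.2 - u.2 * v.1

/-- Real cross product. -/
def crossR (u v : ℝ × ℝ) : ℝ := u.1 * v.2 - u.2 * v.1

/-- A convex integer polygon, given by its (at least three) vertices listed in
counterclockwise order: every vertex lies strictly to the left of every directed edge. -/
structure IntPolygon where
  n : ℕ
  vert : Fin (n + 3) → Z2
  convex : ∀ i j : Fin (n + 3), j ≠ i → j ≠ i + 1 →
    0 < crossZ (vert (i + 1) - vert i) (vert j - vert i)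

namespace IntPolygon

/-- The oriented edge vector from vertex `i` to vertex `i+1`. -/
def edgeVec (P : IntPolygon) (i : Fin (P.n + 3)) : Z2 := P.vert (i + 1) - P.vert i

/-- The polygon as a subset of `ℝ²` (the convex hull of its vertices). -/
def carrier (P : IntPolygon) : Set (ℝ × ℝ) :=
  convexHull ℝ (Set.range fun i => toR2 (P.vert i))

lemma crossZ_smul (m : ℤ) (u v : Z2) : crossZ (m • u) (m • v) = m ^ 2 * crossZ u v := by
  simp only [crossZ, Prod.smul_fst, Prod.smul_snd, smul_eq_mul]
  ring

/-- The dilation of a polygon by a positive integer factor about the origin. -/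
def dilate (P : IntPolygon) (m : ℤ) (hm : 0 < m) : IntPolygon where
  n := P.n
  vert := fun i => m • P.vert i
  convex := by
    intro i j hj hj1
    have h := P.convex i j hj hj1
    have e1 : m • P.vert (i + 1) - m • P.vert i = m • (P.vert (i + 1) - P.vert i) :=
      (smul_sub m _ _).symm
    have e2 : m • P.vert j - m • P.vert i = m • (P.vert j - P.vert i) :=
      (smul_sub m _ _).symm
    rw [e1, e2, crossZ_smul]
    exact mul_pos (pow_pos hm 2) h

end IntPolygon

/-- `P` is a coding polygon for `X`: for each vertex `w`, the polygon with `w`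
removed X-codes `w`. -/
def IsCodingPolygon {A : Type*} (X : Set (Config A)) (P : IntPolygon) : Prop :=
  ∀ i : Fin (P.n + 3),
    Codes X (P.carrier \ {toR2 (P.vert i)}) {toR2 (P.vert i)}

/-- `X` is polygonal with respect to `P`. -/
def Polygonal {A : Type*} (X : Set (Config A)) (P : IntPolygon) : Prop :=
  X.Infinite ∧ IsCodingPolygon X P

/-- The closed half plane `H_v = {w : v₁ w₂ − v₂ w₁ ≥ 0}` to the left of the direction `v`. -/
def leftHalfPlane (v : ℝ × ℝ) : Set (ℝ × ℝ) := {w | 0 ≤ v.1 * w.2 - v.2 * w.1}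

/-- The ray directed by `v` is expansive for `X`: `H_v` X-codes all of `ℝ²`. -/
def ExpansiveRay {A : Type*} (X : Set (Config A)) (v : ℝ × ℝ) : Prop :=
  Codes X (leftHalfPlane v) Set.univ

/-- For a primitive integer direction `v`, the line `L₀`: the translate of `L = ℝ·v`
by an integer vector, lying outside `H_v` and closest to `L`. -/
def lineL0 (v : Z2) : Set (ℝ × ℝ) := {w | (v.1 : ℝ) * w.2 - (v.2 : ℝ) * w.1 = -1}

/-- A block of `m` consecutive lattice points on `L₀`, starting at `z`. -/
def blockOn (v z : Z2) (m : ℕ) : Set (ℝ × ℝ) :=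
  (fun k : ℕ => toR2 (z + (k : ℤ) • v)) '' {k | k < m}

/-- The (nonexpansive) rational ray directed by the primitive vector `v` is closing for `X`. -/
def ClosingRay {A : Type*} (X : Set (Config A)) (v : Z2) : Prop :=
  ∃ N : ℕ, ∀ z : Z2, v.1 * z.2 - v.2 * z.1 = -1 →
    ∀ m : ℕ, N ≤ m →
      Codes X (leftHalfPlane (toR2 v) ∪ blockOn v z m) (lineL0 v)

/-- The sector (with vertex the origin) determined by the rays through `e₁` and `e₂`:
lattice points on either ray or strictly between them. -/
def SectorZ (e₁ e₂ : Z2) : Set Z2 :=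
  {p | SameRay ℝ (toR2 e₁) (toR2 p) ∨ SameRay ℝ (toR2 e₂) (toR2 p) ∨
       (0 < crossZ e₁ p ∧ 0 < crossZ p e₂)}

/-- The rational sector determined by `(e₁, e₂)` is corner coding for `X`. -/
def IsCornerCoding {A : Type*} (X : Set (Config A)) (e₁ e₂ : Z2) : Prop :=
  CodesZ X (SectorZ e₁ e₂ \ {0}) {0}

/-- The rational sector determined by `(e₁, e₂)` is weakly corner coding for `X`. -/
def IsWeaklyCornerCoding {A : Type*} (X : Set (Config A)) (e₁ e₂ : Z2) : Prop :=
  ∃ F₀ : Set Z2, F₀.Finite ∧ F₀ ⊆ SectorZ e₁ e₂ ∧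
    ∀ F : Set Z2, F.Finite → F ⊆ SectorZ e₁ e₂ →
      CodesZ X (SectorZ e₁ e₂ \ F) (SectorZ e₁ e₂ \ F₀)

/-- The sector based at the vertex `i` of the polygon `P`: lattice points in the convex
cone with apex `P.vert i` spanned by the two edges of `P` incident to that vertex. -/
def vertexSector (P : IntPolygon) (i : Fin (P.n + 3)) : Set Z2 :=
  {p | ∃ s t : ℝ, 0 ≤ s ∧ 0 ≤ t ∧
    toR2 p = toR2 (P.vert i) + s • toR2 (P.vert (i - 1) - P.vert i)
      + t • toR2 (P.vert (i + 1) - P.vert i)}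

/-- `P` is a coding polygon for some recoding of `X`. -/
def HasRecodingPolygon {A : Type*} (X : Set (Config A)) (P : IntPolygon) : Prop :=
  ∃ (A' : Type) (_ : Fintype A') (Y : Set (Config A')),
    IsSubshift Y ∧ IsRecoding X Y ∧ IsCodingPolygon Y P

/-- `P` is a minimal recoding polygon for `X`. -/
def IsMinimalRecodingPolygon {A : Type*} (X : Set (Config A)) (P : IntPolygon) : Prop :=
  HasRecodingPolygon X P ∧
  (∀ Q : IntPolygon, HasRecodingPolygon X Q → P.n ≤ Q.n) ∧
  (∀ Q : IntPolygon, HasRecodingPolygon X Q → Q.n = P.n →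
    Q.carrier ⊆ P.carrier → Q.carrier = P.carrier)


/-- `D` is the (finite) set of directions of the nonexpansive rays of `X`: a finite set
of primitive integer vectors, each directing a nonexpansive ray, such that every
nonexpansive ray of `X` has its direction in `D`. -/
def NonexpansiveDirSet {A : Type*} (X : Set (Config A)) (D : Finset Z2) : Prop :=
  (∀ v ∈ D, Int.gcd v.1 v.2 = 1) ∧
  (∀ v ∈ D, ¬ ExpansiveRay X (toR2 v)) ∧
  (∀ u : ℝ × ℝ, u ≠ 0 → ¬ ExpansiveRay X u → ∃ v ∈ D, SameRay ℝ (toR2 v) u)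

/-- The lattice points of the segment from `w₀` to `w₁` (a degenerate polygon). -/
def segZ (w₀ w₁ : Z2) : Set Z2 :=
  {p | ∃ t : ℝ, 0 ≤ t ∧ t ≤ 1 ∧ toR2 p = toR2 w₀ + t • (toR2 w₁ - toR2 w₀)}

section Coding

variable {A : Type*}

lemma CodesZ.mono {X : Set (Config A)} {S S' T T' : Set Z2} (h : CodesZ X S T)
    (hS : S ⊆ S') (hT : T' ⊆ T) : CodesZ X S' T' :=
  fun x hx x' hx' hp p hpT => h x hx x' hx' (fun p hpS => hp p (hS hpS)) p (hT hpT)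

lemma CodesZ.of_forall {X : Set (Config A)} {S T : Set Z2} (h : ∀ q ∈ T, CodesZ X S {q}) :
    CodesZ X S T :=
  fun x hx x' hx' hp q hq => h q hq x hx x' hx' hp q rfl

lemma CodesZ.of_subset {X : Set (Config A)} {S T : Set Z2} (h : T ⊆ S) : CodesZ X S T :=
  fun _ _ _ _ hp q hq => hp q (h hq)

lemma CodesZ.trans {X : Set (Config A)} {S T U : Set Z2} (h : CodesZ X S T)
    (h' : CodesZ X T U) : CodesZ X S U :=
  fun x hx x' hx' hp => h' x hx x' hx' (h x hx x' hx' hp)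

lemma CodesZ.shift {X : Set (Config A)} (hX : IsSubshift X) {S S' T T' : Set Z2}
    (h : CodesZ X S T) (u : Z2) (hS : ∀ p ∈ S, u + p ∈ S') (hT : ∀ p ∈ T', p - u ∈ T) :
    CodesZ X S' T' := by
  intro x hx x' hx' hp p hpT
  have := h _ (hX.2 u x hx) _ (hX.2 u x' hx') (fun p hpS => hp _ (hS p hpS)) _ (hT p hpT)
  simpa [shiftAct] using this

lemma isCompact_of_isClosed_config [Finite A] {X : Set (Config A)}
    (hX : letI : TopologicalSpace A := ⊥
      IsClosed X) :
    letI : TopologicalSpace A := ⊥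
    IsCompact X := by
  let : TopologicalSpace A := ⊥
  have : DiscreteTopology A := ⟨rfl⟩
  exact IsClosed.isCompact hX

lemma CodesZ.exists_finite_singleton [Finite A] {X : Set (Config A)} (hX : IsSubshift X)
    {S : Set Z2} {q : Z2} (h : CodesZ X S {q}) :
    ∃ S' : Set Z2, S'.Finite ∧ S' ⊆ S ∧ CodesZ X S' {q} := by
  let : TopologicalSpace A := ⊥
  have : DiscreteTopology A := ⟨rfl⟩
  have hc : IsCompact X := isCompact_of_isClosed_config hX.1
  let D : Set (Config A × Config A) := {z | z.1 q ≠ z.2 q}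
  have hcont : ∀ p : Z2, Continuous fun z : Config A × Config A => (z.1 p, z.2 p) := by
    intro p
    fun_prop
  have hD : IsClosed D :=
    (isClosed_discrete {a : A × A | a.1 ≠ a.2}).preimage (hcont q)
  have hK : IsCompact ((X ×ˢ X) ∩ D) := (hc.prod hc).inter_right hD
  let E : S → Set (Config A × Config A) := fun p => {z | z.1 p = z.2 p}
  have hE : ∀ p, IsClosed (E p) := fun p =>
    (isClosed_discrete {a : A × A | a.1 = a.2}).preimage (hcont p)
  obtain ⟨t, ht⟩ := hK.elim_finite_subfamily_closed E hE (by
    ext z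
    simp only [Set.mem_inter_iff, Set.mem_iInter, Set.mem_empty_iff_false, iff_false]
    rintro ⟨⟨⟨h1, h2⟩, h3⟩, h4⟩
    exact h3 (h z.1 h1 z.2 h2 (fun p hp => h4 ⟨p, hp⟩) q rfl))
  refine ⟨Subtype.val '' (t : Set S), (t.finite_toSet).image _, ?_, ?_⟩
  · rintro _ ⟨p, _, rfl⟩
    exact p.2
  · intro x hx x' hx' hp q' hq'
    rw [Set.mem_singleton_iff] at hq'
    subst hq'
    by_contra hne
    have : ((x, x') : Config A × Config A) ∈ (∅ : Set (Config A × Config A)) := by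
      rw [← ht]
      refine ⟨⟨⟨hx, hx'⟩, hne⟩, ?_⟩
      simp only [Set.mem_iInter]
      exact fun p hpt => hp p ⟨p, hpt, rfl⟩
    exact this

lemma CodesZ.exists_finite [Finite A] {X : Set (Config A)} (hX : IsSubshift X)
    {S T : Set Z2} (hT : T.Finite) (h : CodesZ X S T) :
    ∃ S' : Set Z2, S'.Finite ∧ S' ⊆ S ∧ CodesZ X S' T := by
  have key : ∀ q : T, ∃ S' : Set Z2, S'.Finite ∧ S' ⊆ S ∧ CodesZ X S' {q.1} := fun q =>
    CodesZ.exists_finite_singleton hX (h.mono subset_rfl (by simp))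
  choose f hf1 hf2 hf3 using key
  have := hT.to_subtype
  refine ⟨⋃ q, f q, Set.finite_iUnion hf1, Set.iUnion_subset hf2, ?_⟩
  exact CodesZ.of_forall fun q hq => (hf3 ⟨q, hq⟩).mono (Set.subset_iUnion f ⟨q, hq⟩) subset_rfl

/-- A block recoding over a nonempty finite window. -/
lemma exists_recoding {A : Type} [Fintype A] {X : Set (Config A)} (hX : IsSubshift X)
    {F : Set Z2} (hF : F.Finite) (hne : F.Nonempty) :
    ∃ (A' : Type) (_ : Fintype A') (Y : Set (Config A')), IsSubshift Y ∧ IsRecoding X Y ∧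
      ∀ S T : Set Z2, CodesZ X {p | ∃ s ∈ S, p - s ∈ F} {p | ∃ s ∈ T, p - s ∈ F} →
        CodesZ Y S T := by
  classical
  have := hF.fintype
  let Φ : Config A → Config (F → A) := fun x u f => x (f + u)
  have hΦ : ∀ (u : Z2) (x x' : Config A),
      Φ x u = Φ x' u ↔ ∀ f ∈ F, x (f + u) = x' (f + u) := by
    intro u x x'
    constructor
    · intro h f hf
      exact congrFun h ⟨f, hf⟩
    · intro h
      ext f
      exact h f f.2
  have hinj : Function.Injective Φ := by
    intro x x' h
    obtain ⟨f, hf⟩ := hne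
    ext p
    have := (hΦ (p - f) x x').1 (by rw [h]) f hf
    simpa using this
  have heq : ∀ (u : Z2) (x : Config A), Φ (shiftAct u x) = shiftAct u (Φ x) := by
    intro u x
    ext w f
    simp only [Φ, shiftAct]
    congr 1
    abel
  let tA : TopologicalSpace A := ⊥
  have : DiscreteTopology A := ⟨rfl⟩
  let tB : TopologicalSpace (F → A) := ⊥
  have : DiscreteTopology (F → A) := ⟨rfl⟩
  have hcont : Continuous Φ := by
    refine continuous_pi fun u => ?_
    have h1 : (fun x : Config A => Φ x u) =
        (fun y : F → A => y) ∘ (fun x : Config A => fun f : F => x (f + u)) := rfl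
    rw [h1]
    have h2 : @Continuous (Config A) (F → A) _ Pi.topologicalSpace
        (fun x : Config A => fun f : F => x (f + u)) := by
      refine @continuous_pi _ _ _ _ _ _ fun f => ?_
      exact continuous_apply _
    have h3 : @Continuous (F → A) (F → A) Pi.topologicalSpace tB (fun y => y) := by
      have : @DiscreteTopology (F → A) Pi.topologicalSpace := Pi.discreteTopology
      exact @continuous_of_discreteTopology _ Pi.topologicalSpace this _ _ _
    exact @Continuous.comp _ _ _ _ Pi.topologicalSpace tB _ _ h3 h2
  have hc : IsCompact X := isCompact_of_isClosed_config hX.1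
  refine ⟨F → A, inferInstance, Φ '' X, ⟨(hc.image hcont).isClosed, ?_⟩, ⟨F, hF, ?_⟩, ?_⟩
  · rintro u _ ⟨x, hx, rfl⟩
    exact ⟨_, hX.2 u x hx, heq u x⟩
  · have : CompactSpace X := isCompact_iff_compactSpace.1 hc
    let e : X ≃ (Φ '' X) := Equiv.Set.image Φ X hinj
    have he : Continuous e := by
      refine Continuous.subtype_mk ?_ _
      exact hcont.comp continuous_subtype_val
    refine ⟨he.homeoOfEquivCompactToT2, ?_, ?_⟩
    · intro u x x' h
      change Φ x' = shiftAct u (Φ x)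
      rw [h, heq]
    · intro u x x'
      exact hΦ u x x'
  · rintro S T h _ ⟨x, hx, rfl⟩ _ ⟨x', hx', rfl⟩ hp q hq
    rw [hΦ]
    intro f hf
    refine h x hx x' hx' ?_ (f + q) ⟨q, hq, by simpa using hf⟩
    rintro p ⟨s, hs, hps⟩
    have := (hΦ s x x').1 (hp s hs) _ hps
    simpa using this

end Coding

section Corner

lemma crossZ_add_right (a b c : Z2) : crossZ a (b + c) = crossZ a b + crossZ a c := by
  simp only [crossZ, Prod.fst_add, Prod.snd_add]
  ring

lemma crossZ_sub_right (a b c : Z2) : crossZ a (b - c) = crossZ a b - crossZ a c := by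
  simp only [crossZ, Prod.fst_sub, Prod.snd_sub]
  ring

lemma crossZ_smul_right (m : ℤ) (a b : Z2) : crossZ a (m • b) = m * crossZ a b := by
  simp only [crossZ, Prod.smul_fst, Prod.smul_snd, smul_eq_mul]
  ring

lemma crossZ_smul_left (m : ℤ) (a b : Z2) : crossZ (m • a) b = m * crossZ a b := by
  simp only [crossZ, Prod.smul_fst, Prod.smul_snd, smul_eq_mul]
  ring

lemma crossZ_neg_right (a b : Z2) : crossZ a (-b) = -crossZ a b := by
  simp only [crossZ, Prod.fst_neg, Prod.snd_neg]
  ring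

lemma crossZ_neg_left (a b : Z2) : crossZ (-a) b = -crossZ a b := by
  simp only [crossZ, Prod.fst_neg, Prod.snd_neg]
  ring

lemma crossZ_self (a : Z2) : crossZ a a = 0 := by
  simp only [crossZ]
  ring

lemma crossZ_comm (a b : Z2) : crossZ a b = -crossZ b a := by
  simp only [crossZ]
  ring

lemma crossZ_zero_right (a : Z2) : crossZ a 0 = 0 := by
  simp [crossZ]

/-- The Plücker relation between three plane vectors, paired with a fourth. -/
lemma crossZ_plucker (a b c p : Z2) :
    crossZ a c * crossZ b p = crossZ b c * crossZ a p + crossZ a b * crossZ c p := by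
  simp only [crossZ]
  ring

variable {A : Type*}

/-- A point is coded by the open half plane to the left of `v` together with finitely many
preceding (or, alternatively, following) points on its line in direction `v`. -/
def TwoSidedClosing (X : Set (Config A)) (v : Z2) : Prop :=
  ∃ N : ℤ, CodesZ X ({p | 1 ≤ crossZ v p} ∪ {p | ∃ k : ℤ, 1 ≤ k ∧ k ≤ N ∧ p = -(k • v)}) {0} ∧
    CodesZ X ({p | 1 ≤ crossZ v p} ∪ {p | ∃ k : ℤ, 1 ≤ k ∧ k ≤ N ∧ p = k • v}) {0}

lemma ClosingRay.twoSidedClosing {X : Set (Config A)} (hX : IsSubshift X) {v : Z2}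
    (hv : Int.gcd v.1 v.2 = 1) (h : ClosingRay X v) : TwoSidedClosing X v := by
  obtain ⟨N, hN⟩ := h
  obtain ⟨z, hz⟩ : ∃ z : Z2, crossZ v z = -1 := by
    refine ⟨(Int.gcdB v.1 v.2, -Int.gcdA v.1 v.2), ?_⟩
    have := Int.gcd_eq_gcd_ab v.1 v.2
    rw [hv] at this
    simp only [crossZ]
    push_cast at this
    linarith
  have hcode := hN z hz N le_rfl
  have hmem : ∀ p : Z2, toR2 p ∈ leftHalfPlane (toR2 v) ↔ 0 ≤ crossZ v p := by
    intro p
    simp only [leftHalfPlane, toR2, crossZ, Set.mem_ofPred_eq]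
    exact_mod_cast Iff.rfl
  have hline : ∀ p : Z2, toR2 p ∈ lineL0 v ↔ crossZ v p = -1 := by
    intro p
    simp only [lineL0, toR2, crossZ, Set.mem_ofPred_eq]
    exact_mod_cast Iff.rfl
  have hinj : Function.Injective toR2 := by
    intro p q hpq
    simp only [toR2, Prod.mk.injEq, Int.cast_inj] at hpq
    exact Prod.ext hpq.1 hpq.2
  have hblock : ∀ p : Z2, toR2 p ∈ blockOn v z N → ∃ k : ℤ, 0 ≤ k ∧ k < N ∧ p = z + k • v := by
    rintro p ⟨k, hk, hkp⟩
    exact ⟨k, by positivity, by exact_mod_cast hk, (hinj hkp).symm⟩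
  have hcodeZ : CodesZ X ({p | 0 ≤ crossZ v p} ∪ {p | ∃ k : ℤ, 0 ≤ k ∧ k < N ∧ p = z + k • v})
      {p | crossZ v p = -1} := by
    intro x hx x' hx' hp p hpT
    refine hcode x hx x' hx' ?_ p ((hline p).2 hpT)
    rintro p (hp' | hp')
    · exact hp p (Or.inl ((hmem p).1 hp'))
    · exact hp p (Or.inr (hblock p hp'))
  refine ⟨N, hcodeZ.shift hX (-(z + (N : ℤ) • v)) ?_ ?_, hcodeZ.shift hX (-(z - v)) ?_ ?_⟩
  · rintro p (hp | ⟨k, hk0, hkN, rfl⟩)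
    · left
      simp only [Set.mem_ofPred_eq] at hp ⊢
      rw [crossZ_add_right, crossZ_neg_right, crossZ_add_right, crossZ_smul_right, crossZ_self, hz]
      linarith
    · right
      refine ⟨N - k, by linarith, by linarith, ?_⟩
      rw [sub_smul]
      abel
  · rintro p rfl
    simp only [Set.mem_ofPred_eq, zero_sub, neg_neg, crossZ_add_right, crossZ_smul_right,
      crossZ_self, hz]
    ring
  · rintro p (hp | ⟨k, hk0, hkN, rfl⟩)
    · left
      simp only [Set.mem_ofPred_eq] at hp ⊢
      rw [crossZ_add_right, crossZ_neg_right, crossZ_sub_right, crossZ_self, hz]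
      linarith
    · right
      refine ⟨k + 1, by linarith, by linarith, ?_⟩
      rw [add_smul, one_smul]
      abel
  · rintro p rfl
    simp only [Set.mem_ofPred_eq, zero_sub, neg_neg, crossZ_sub_right, crossZ_self, hz]
    ring

lemma ExpansiveRay.closingRay {X : Set (Config A)} {v : Z2} (h : ExpansiveRay X (toR2 v)) :
    ClosingRay X v :=
  ⟨0, fun _ _ _ _ x hx x' hx' hp p _ =>
    h x hx x' hx' (fun p hpS => hp p (Or.inl hpS)) p (Set.mem_univ _)⟩

/-- For an expansive direction every half plane, however far away, codes everything. -/
lemma ExpansiveRay.codesZ_halfPlane {X : Set (Config A)} (hX : IsSubshift X) {v : ℝ × ℝ}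
    (hv : v ≠ 0) (h : ExpansiveRay X v) (c : ℝ) :
    CodesZ X {p | c ≤ crossR v (toR2 p)} Set.univ := by
  obtain ⟨u, hu⟩ : ∃ u : Z2, c ≤ crossR v (toR2 u) := by
    have hsmall : ∀ a : ℝ, a ≠ 0 → ∃ k : ℤ, c ≤ a * k := by
      intro a ha
      rcases lt_or_gt_of_ne ha with ha | ha
      · refine ⟨⌊c / a⌋, ?_⟩
        have := mul_le_mul_of_nonpos_left (Int.floor_le (c / a)) ha.le
        rwa [mul_div_cancel₀ _ ha.ne] at this
      · refine ⟨⌈c / a⌉, ?_⟩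
        have := mul_le_mul_of_nonneg_left (Int.le_ceil (c / a)) ha.le
        rwa [mul_div_cancel₀ _ ha.ne'] at this
    by_cases h1 : v.1 = 0
    · have h2 : v.2 ≠ 0 := fun h2 => hv (Prod.ext h1 h2)
      obtain ⟨k, hk⟩ := hsmall _ h2
      refine ⟨(-k, 0), ?_⟩
      simp only [crossR, toR2]
      push_cast
      linarith
    · obtain ⟨k, hk⟩ := hsmall _ h1
      refine ⟨(0, k), ?_⟩
      simp only [crossR, toR2]
      push_cast
      linarith
  have h0 : CodesZ X {p | 0 ≤ crossR v (toR2 p)} Set.univ := by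
    intro x hx x' hx' hp p _
    exact h x hx x' hx' (fun p hpS => hp p hpS) p (Set.mem_univ _)
  refine h0.shift hX u (fun p hp => ?_) fun _ _ => Set.mem_univ _
  simp only [Set.mem_ofPred_eq, crossR, toR2, Prod.fst_add, Prod.snd_add] at *
  push_cast
  linarith

/-- A finite set has bounded coordinates `crossZ v ·`. -/
lemma exists_crossZ_bound {S : Set Z2} (hS : S.Finite) (v₁ v₂ : Z2) :
    ∃ r : ℤ, 0 ≤ r ∧ ∀ p ∈ S, |crossZ v₁ p| ≤ r ∧ |crossZ v₂ p| ≤ r := by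
  obtain ⟨b, hb⟩ := (hS.image fun p => |crossZ v₁ p| + |crossZ v₂ p|).bddAbove
  refine ⟨max b 0, le_max_right _ _, fun p hp => ?_⟩
  have h1 := hb (Set.mem_image_of_mem _ hp)
  have h2 := abs_nonneg (crossZ v₁ p)
  have h3 := abs_nonneg (crossZ v₂ p)
  have h4 := le_max_left b 0
  constructor <;> linarith

/-- Uniform local coding for a compact set of expansive directions. -/
lemma exists_uniform_halfPlane [Finite A] {X : Set (Config A)} (hX : IsSubshift X)
    {v₁ v₂ : Z2} (hδ : 0 < crossZ v₁ v₂)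
    (hexp : ∀ s t : ℝ, 0 < s → 0 < t → ExpansiveRay X (s • toR2 v₁ + t • toR2 v₂))
    {a b : ℝ} (ha : 0 < a) :
    ∃ r : ℤ, 0 ≤ r ∧ ∀ t ∈ Set.Icc a b,
      CodesZ X {p | |crossZ v₁ p| ≤ r ∧ |crossZ v₂ p| ≤ r ∧
        (1 : ℝ) ≤ crossZ v₁ p + t * crossZ v₂ p} {0} := by
  refine isCompact_Icc.induction_on
    (p := fun s => ∃ r : ℤ, 0 ≤ r ∧ ∀ t ∈ s,
      CodesZ X {p | |crossZ v₁ p| ≤ r ∧ |crossZ v₂ p| ≤ r ∧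
        (1 : ℝ) ≤ crossZ v₁ p + t * crossZ v₂ p} {0}) ?_ ?_ ?_ ?_
  · exact ⟨0, le_rfl, by simp⟩
  · rintro s s' hss ⟨r, hr0, hr⟩
    exact ⟨r, hr0, fun t ht => hr t (hss ht)⟩
  · rintro s s' ⟨r, hr0, hr⟩ ⟨r', hr0', hr'⟩
    refine ⟨max r r', le_max_of_le_left hr0, ?_⟩
    rintro t (ht | ht)
    · refine (hr t ht).mono ?_ subset_rfl
      rintro p ⟨h1, h2, h3⟩
      exact ⟨le_max_of_le_left h1, le_max_of_le_left h2, h3⟩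
    · refine (hr' t ht).mono ?_ subset_rfl
      rintro p ⟨h1, h2, h3⟩
      exact ⟨le_max_of_le_right h1, le_max_of_le_right h2, h3⟩
  · intro t ht
    have ht0 : 0 < t := ha.trans_le ht.1
    have hE := hexp 1 t one_pos ht0
    have hcr : ∀ p : Z2, crossR ((1 : ℝ) • toR2 v₁ + t • toR2 v₂) (toR2 p) =
        crossZ v₁ p + t * crossZ v₂ p := by
      intro p
      simp only [crossR, crossZ, toR2, Prod.fst_add, Prod.snd_add, Prod.smul_fst, Prod.smul_snd,
        smul_eq_mul]
      push_cast
      ring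
    have hne : (1 : ℝ) • toR2 v₁ + t • toR2 v₂ ≠ 0 := by
      intro h0
      have h1 := hcr v₁
      rw [h0, crossZ_self, crossZ_comm v₂ v₁] at h1
      have h2 : (0 : ℝ) < crossZ v₁ v₂ := by exact_mod_cast hδ
      have h3 := mul_pos ht0 h2
      simp only [crossR] at h1
      push_cast at h1
      simp at h1
      rcases h1 with h1 | h1
      · linarith
      · rw [h1] at hδ
        exact lt_irrefl _ hδ
    have hcode := hE.codesZ_halfPlane hX hne 2
    obtain ⟨S, hSf, hS, hSc⟩ := CodesZ.exists_finite_singleton hX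
      (hcode.mono subset_rfl (Set.subset_univ {0}))
    obtain ⟨r, hr0, hr⟩ := exists_crossZ_bound hSf v₁ v₂
    have hpos : (0 : ℝ) < 1 / (r + 1) := by
      have : (0 : ℝ) ≤ r := by exact_mod_cast hr0
      positivity
    refine ⟨Metric.ball t (1 / (r + 1)),
      mem_nhdsWithin_of_mem_nhds (Metric.ball_mem_nhds _ hpos), r, hr0, ?_⟩
    intro t' ht'
    refine hSc.mono ?_ subset_rfl
    intro p hp
    refine ⟨(hr p hp).1, (hr p hp).2, ?_⟩
    have h2 := hS hp
    simp only [Set.mem_ofPred_eq, hcr] at h2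
    rw [Metric.mem_ball, Real.dist_eq] at ht'
    have hr0' : (0 : ℝ) ≤ r := by exact_mod_cast hr0
    have h3 : |(t' - t) * (crossZ v₂ p : ℝ)| ≤ 1 := by
      rw [abs_mul]
      have h4 : |(crossZ v₂ p : ℝ)| ≤ r := by exact_mod_cast (hr p hp).2
      calc |t' - t| * |(crossZ v₂ p : ℝ)| ≤ (1 / (r + 1)) * r := by gcongr
        _ ≤ 1 := by
          rw [div_mul_eq_mul_div, one_mul, div_le_one (by linarith)]
          linarith
    have h5 := (abs_le.1 h3).1
    linarith [h5]

/-- The level function of the corner spanned by `-v₁` and `v₂`. -/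
def cornerLevel (v₁ v₂ p : Z2) : ℤ := (crossZ v₂ p + 1) * (crossZ v₁ p + 1)

/-- The corner spanned by `-v₁` and `v₂` is coded locally: a point of level at least `C` is
determined by the points of strictly larger level at distance at most `r`. -/
def LocalCornerCoding (X : Set (Config A)) (v₁ v₂ : Z2) (r C : ℤ) : Prop :=
  ∀ q : Z2, 0 ≤ crossZ v₁ q → 0 ≤ crossZ v₂ q → C ≤ cornerLevel v₁ v₂ q →
    CodesZ X {p | |crossZ v₁ (p - q)| ≤ r ∧ |crossZ v₂ (p - q)| ≤ r ∧
      0 ≤ crossZ v₁ p ∧ 0 ≤ crossZ v₂ p ∧ cornerLevel v₁ v₂ q < cornerLevel v₁ v₂ p} {q}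

lemma LocalCornerCoding.mono {X : Set (Config A)} {v₁ v₂ : Z2} {r r' C C' : ℤ}
    (h : LocalCornerCoding X v₁ v₂ r C) (hr : r ≤ r') (hC : C ≤ C') :
    LocalCornerCoding X v₁ v₂ r' C' := by
  intro q h1 h2 h3
  refine (h q h1 h2 (hC.trans h3)).mono ?_ subset_rfl
  rintro p ⟨h4, h5, h6⟩
  exact ⟨h4.trans hr, h5.trans hr, h6⟩

lemma exists_localCornerCoding [Finite A] {X : Set (Config A)} (hX : IsSubshift X)
    {v₁ v₂ : Z2} (hδ : 0 < crossZ v₁ v₂) (h₁ : TwoSidedClosing X v₁) (h₂ : TwoSidedClosing X v₂)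
    (hexp : ∀ s t : ℝ, 0 < s → 0 < t → ExpansiveRay X (s • toR2 v₁ + t • toR2 v₂)) :
    ∃ r C : ℤ, LocalCornerCoding X v₁ v₂ r C := by
  obtain ⟨N₁, hN₁, -⟩ := h₁
  obtain ⟨N₂, -, hN₂⟩ := h₂
  obtain ⟨S₁, hS₁f, hS₁, hc₁⟩ := CodesZ.exists_finite_singleton hX hN₁
  obtain ⟨S₂, hS₂f, hS₂, hc₂⟩ := CodesZ.exists_finite_singleton hX hN₂
  obtain ⟨r₁, hr₁0, hr₁⟩ := exists_crossZ_bound hS₁f v₁ v₂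
  obtain ⟨r₂, hr₂0, hr₂⟩ := exists_crossZ_bound hS₂f v₁ v₂
  set Λ : ℤ := 2 * (r₁ + r₂) + 2 with hΛ
  have hΛpos : 0 < Λ := by linarith
  have hΛR : (0 : ℝ) < Λ := by exact_mod_cast hΛpos
  obtain ⟨r₃, hr₃0, hr₃⟩ := exists_uniform_halfPlane hX hδ hexp (a := 1 / Λ) (b := Λ)
    (by positivity)
  set K : ℤ := r₃ ^ 2 + r₃ + 1 with hK
  refine ⟨r₁ + r₂ + r₃, Λ * K ^ 2, fun q hβ hα hC => ?_⟩
  set x := crossZ v₂ q + 1 with hx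
  set y := crossZ v₁ q + 1 with hy
  have hlev : cornerLevel v₁ v₂ q = x * y := rfl
  have hx1 : 1 ≤ x := by linarith
  have hy1 : 1 ≤ y := by linarith
  rw [hlev] at hC
  have hrel : ∀ d : Z2, cornerLevel v₁ v₂ (q + d) = (x + crossZ v₂ d) * (y + crossZ v₁ d) := by
    intro d
    simp only [cornerLevel, crossZ_add_right, hx, hy]
    ring
  have hgoal : ∀ {S : Set Z2} {r : ℤ}, CodesZ X S {0} → r ≤ r₁ + r₂ + r₃ →
      (∀ d ∈ S, |crossZ v₁ d| ≤ r ∧ |crossZ v₂ d| ≤ r ∧ 0 < y + crossZ v₁ d ∧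
        0 < x + crossZ v₂ d ∧ x * y < (x + crossZ v₂ d) * (y + crossZ v₁ d)) →
      CodesZ X {p | |crossZ v₁ (p - q)| ≤ r₁ + r₂ + r₃ ∧ |crossZ v₂ (p - q)| ≤ r₁ + r₂ + r₃ ∧
      0 ≤ crossZ v₁ p ∧ 0 ≤ crossZ v₂ p ∧ cornerLevel v₁ v₂ q < cornerLevel v₁ v₂ p} {q} := by
    intro S r hS hr hd
    refine hS.shift hX q (fun d hdS => ?_) (by simp)
    obtain ⟨h1, h2, h3, h4, h5⟩ := hd d hdS
    refine ⟨?_, ?_, ?_, ?_, ?_⟩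
    · rw [add_sub_cancel_left]
      exact h1.trans hr
    · rw [add_sub_cancel_left]
      exact h2.trans hr
    · rw [crossZ_add_right]
      linarith
    · rw [crossZ_add_right]
      linarith
    · rw [hlev, hrel]
      exact h5
  by_cases hc1 : Λ * y ≤ x
  · refine hgoal hc₁ (r := r₁) (by linarith) fun d hd => ?_
    obtain ⟨hb1, hb2⟩ := hr₁ d hd
    refine ⟨hb1, hb2, ?_⟩
    rw [abs_le] at hb1 hb2
    rcases hS₁ hd with hd | ⟨k, hk1, -, rfl⟩
    · simp only [Set.mem_ofPred_eq] at hd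
      refine ⟨by linarith, by nlinarith, ?_⟩
      have h3 : 0 ≤ x - r₁ := by nlinarith
      have : (x - r₁) * (y + 1) ≤ (x + crossZ v₂ d) * (y + crossZ v₁ d) := by
        apply mul_le_mul <;> linarith
      nlinarith
    · rw [crossZ_neg_right, crossZ_neg_right, crossZ_smul_right, crossZ_smul_right, crossZ_self,
        crossZ_comm v₂ v₁]
      have : 0 < k * crossZ v₁ v₂ := mul_pos (by linarith) hδ
      refine ⟨by linarith, by linarith, by nlinarith⟩
  by_cases hc2 : Λ * x ≤ y
  · refine hgoal hc₂ (r := r₂) (by linarith) fun d hd => ?_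
    obtain ⟨hb1, hb2⟩ := hr₂ d hd
    refine ⟨hb1, hb2, ?_⟩
    rw [abs_le] at hb1 hb2
    rcases hS₂ hd with hd | ⟨k, hk1, -, rfl⟩
    · simp only [Set.mem_ofPred_eq] at hd
      refine ⟨by nlinarith, by linarith, ?_⟩
      have h3 : 0 ≤ y - r₂ := by nlinarith
      have : (x + 1) * (y - r₂) ≤ (x + crossZ v₂ d) * (y + crossZ v₁ d) := by
        apply mul_le_mul <;> linarith
      nlinarith
    · rw [crossZ_smul_right, crossZ_smul_right, crossZ_self]
      have : 0 < k * crossZ v₁ v₂ := mul_pos (by linarith) hδ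
      refine ⟨by linarith, by linarith, by nlinarith⟩
  push Not at hc1 hc2
  have hKpos : 0 < K := by positivity
  have hxK : K < x := by
    by_contra hle
    push Not at hle
    have h1 : x * y < x * (Λ * x) := by
      apply mul_lt_mul_of_pos_left hc2
      linarith
    have h2 : x * x ≤ K * K := mul_le_mul hle hle (by linarith) hKpos.le
    nlinarith
  have hyK : K < y := by
    by_contra hle
    push Not at hle
    have h1 : x * y < (Λ * y) * y := by
      apply mul_lt_mul_of_pos_right hc1
      linarith
    have h2 : y * y ≤ K * K := mul_le_mul hle hle (by linarith) hKpos.le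
    nlinarith
  have hxR : (0 : ℝ) < x := by exact_mod_cast (by linarith : 0 < x)
  have hyR : (0 : ℝ) < y := by exact_mod_cast (by linarith : 0 < y)
  refine hgoal (hr₃ ((y : ℝ) / x) ⟨?_, ?_⟩) (r := r₃) (by linarith) fun d hd => ?_
  · rw [div_le_div_iff₀ hΛR hxR]
    exact_mod_cast (by linarith : 1 * x ≤ y * Λ)
  · rw [div_le_iff₀ hxR]
    exact_mod_cast hc2.le
  · obtain ⟨hb1, hb2, h1⟩ := hd
    refine ⟨hb1, hb2, ?_⟩
    have h2 : x ≤ x * crossZ v₁ d + y * crossZ v₂ d := by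
      have h3 := mul_le_mul_of_nonneg_left h1 hxR.le
      have h4 : (x : ℝ) * (crossZ v₁ d + (y : ℝ) / x * crossZ v₂ d) =
          x * crossZ v₁ d + y * crossZ v₂ d := by
        field_simp
      rw [h4, mul_one] at h3
      exact_mod_cast h3
    have h5 : -(r₃ ^ 2) ≤ crossZ v₂ d * crossZ v₁ d := by
      have h6 : |crossZ v₂ d * crossZ v₁ d| ≤ r₃ * r₃ := by
        rw [abs_mul]
        exact mul_le_mul hb2 hb1 (abs_nonneg _) hr₃0
      have := (abs_le.1 h6).1
      nlinarith
    rw [abs_le] at hb1 hb2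
    have hsq := sq_nonneg r₃
    refine ⟨by linarith, by linarith, by nlinarith⟩

/-- A set containing all points of large level near the corner at `W` codes the points of
moderate level near that corner. -/
lemma LocalCornerCoding.codesZ {X : Set (Config A)} (hX : IsSubshift X) {v₁ v₂ : Z2} {r C : ℤ}
    (h : LocalCornerCoding X v₁ v₂ r C) (W : Z2) (C₁ : ℤ) (T : Set Z2)
    (hT : ∀ q : Z2, 0 ≤ crossZ v₁ q → 0 ≤ crossZ v₂ q → C₁ ≤ cornerLevel v₁ v₂ q →
      crossZ v₁ q ≤ C₁ + r → crossZ v₂ q ≤ C₁ + r → W + q ∈ T)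
    (q : Z2) (hβ : 0 ≤ crossZ v₁ q) (hα : 0 ≤ crossZ v₂ q) (hC : C ≤ cornerLevel v₁ v₂ q)
    (hC₁ : cornerLevel v₁ v₂ q < C₁) : CodesZ X T {W + q} := by
  obtain ⟨n, hn⟩ : ∃ n : ℕ, C₁ - cornerLevel v₁ v₂ q ≤ n :=
    ⟨(C₁ - cornerLevel v₁ v₂ q).toNat, Int.self_le_toNat _⟩
  induction n generalizing q with
  | zero =>
    push_cast at hn
    linarith
  | succ n ih =>
    have hloc := (h q hβ hα hC).shift hX W (S' := {p | p - W ∈ {p | |crossZ v₁ (p - q)| ≤ r ∧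
      |crossZ v₂ (p - q)| ≤ r ∧ 0 ≤ crossZ v₁ p ∧ 0 ≤ crossZ v₂ p ∧
      cornerLevel v₁ v₂ q < cornerLevel v₁ v₂ p}}) (T' := {W + q}) (by simp) (by simp)
    refine CodesZ.trans (CodesZ.of_forall fun p hp => ?_) hloc
    obtain ⟨h1, h2, h3, h4, h5⟩ := hp
    have hpW : p = W + (p - W) := by abel
    rw [hpW]
    by_cases hlev : cornerLevel v₁ v₂ (p - W) < C₁
    · refine ih (p - W) h3 h4 (hC.trans h5.le) hlev ?_
      push_cast at hn
      linarith
    · push Not at hlev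
      refine CodesZ.of_subset (Set.singleton_subset_iff.2 (hT _ h3 h4 hlev ?_ ?_))
      · rw [crossZ_sub_right] at h1
        have := (abs_le.1 h1).2
        have h6 : crossZ v₁ q + 1 ≤ cornerLevel v₁ v₂ q := by
          simp only [cornerLevel]
          nlinarith
        linarith
      · rw [crossZ_sub_right] at h2
        have := (abs_le.1 h2).2
        have h6 : crossZ v₂ q + 1 ≤ cornerLevel v₁ v₂ q := by
          simp only [cornerLevel]
          nlinarith
        linarith

end Corner

section Window

variable {P : IntPolygon} {v : Fin (P.n + 3) → Z2} {m : Fin (P.n + 3) → ℤ}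

lemma fin_add_one_ne {n : ℕ} (k : Fin (n + 3)) : k + 1 ≠ k := by
  intro h
  have : (1 : Fin (n + 3)) = 0 := add_left_cancel (a := k) (by rw [h, add_zero])
  simp at this

lemma fin_add_two_ne {n : ℕ} (k : Fin (n + 3)) : k + 1 + 1 ≠ k := by
  intro h
  have h2 : (1 + 1 : Fin (n + 3)) = 0 := add_left_cancel (a := k) (by rw [← add_assoc, h, add_zero])
  have h3 := congrArg Fin.val h2
  rw [Fin.val_add] at h3
  simp at h3
  rw [Nat.mod_eq_of_lt (by omega)] at h3
  omega

lemma fin_sub_one_ne {n : ℕ} (k : Fin (n + 3)) : k - 1 ≠ k := by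
  intro h
  have := fin_add_one_ne (k - 1)
  rw [sub_add_cancel] at this
  exact this h.symm

/-- The `k`-th edge function of the dilation of `P` by `L`. -/
def edgeFun (P : IntPolygon) (v : Fin (P.n + 3) → Z2) (L : ℤ) (k : Fin (P.n + 3)) (q : Z2) : ℤ :=
  crossZ (v k) (q - L • P.vert k)

lemma edgeFun_sub (L M : ℤ) (k : Fin (P.n + 3)) (q w : Z2) :
    edgeFun P v L k (q - w) = edgeFun P v (L + M) k q - edgeFun P v M k w := by
  simp only [edgeFun, crossZ_sub_right, crossZ_smul_right]
  ring

lemma edgeFun_add (L : ℤ) (k : Fin (P.n + 3)) (q d : Z2) :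
    edgeFun P v L k (q + d) = edgeFun P v L k q + crossZ (v k) d := by
  simp only [edgeFun, crossZ_sub_right, crossZ_add_right, crossZ_smul_right]
  ring

lemma crossZ_sub_smul_vert (L : ℤ) (k j : Fin (P.n + 3)) (q : Z2) :
    crossZ (v k) (q - L • P.vert j) = edgeFun P v L k q - L * edgeFun P v 1 k (P.vert j) := by
  simp only [edgeFun, crossZ_sub_right, crossZ_smul_right]
  ring

/-- `v` and `m` record the directions and the lengths of the edges of `P`. -/
def HasEdges (P : IntPolygon) (v : Fin (P.n + 3) → Z2) (m : Fin (P.n + 3) → ℤ) : Prop :=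
  ∀ i, 0 < m i ∧ P.edgeVec i = m i • v i

lemma HasEdges.one_le_edgeFun (h : HasEdges P v m) {k j : Fin (P.n + 3)} (h1 : j ≠ k)
    (h2 : j ≠ k + 1) : 1 ≤ edgeFun P v 1 k (P.vert j) := by
  have h3 := P.convex k j h1 h2
  have h4 := (h k).2
  rw [IntPolygon.edgeVec] at h4
  rw [h4, crossZ_smul_left] at h3
  simp only [edgeFun, one_smul]
  exact pos_of_mul_pos_right h3 (h k).1.le

lemma edgeFun_self (k : Fin (P.n + 3)) : edgeFun P v 1 k (P.vert k) = 0 := by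
  simp [edgeFun, crossZ]

lemma HasEdges.edgeFun_succ (h : HasEdges P v m) (k : Fin (P.n + 3)) :
    edgeFun P v 1 k (P.vert (k + 1)) = 0 := by
  have h4 := (h k).2
  rw [IntPolygon.edgeVec] at h4
  rw [edgeFun, one_smul, h4, crossZ_smul_right, crossZ_self, mul_zero]

lemma HasEdges.edgeFun_pred (h : HasEdges P v m) (k : Fin (P.n + 3)) :
    edgeFun P v 1 (k - 1) (P.vert k) = 0 := by
  have := h.edgeFun_succ (k - 1)
  rwa [sub_add_cancel] at this

lemma HasEdges.edgeFun_nonneg (h : HasEdges P v m) (k j : Fin (P.n + 3)) :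
    0 ≤ edgeFun P v 1 k (P.vert j) := by
  by_cases h1 : j = k
  · rw [h1, edgeFun_self]
  by_cases h2 : j = k + 1
  · rw [h2, h.edgeFun_succ]
  linarith [h.one_le_edgeFun h1 h2]

lemma HasEdges.one_le_crossZ (h : HasEdges P v m) (k : Fin (P.n + 3)) :
    1 ≤ crossZ (v k) (v (k + 1)) := by
  have h1 := h.one_le_edgeFun (k := k) (j := k + 1 + 1) (fin_add_two_ne k) (fin_add_one_ne _)
  have h2 := (h (k + 1)).2
  rw [IntPolygon.edgeVec, sub_eq_iff_eq_add'] at h2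
  rw [h2, edgeFun_add, h.edgeFun_succ, crossZ_smul_right, zero_add] at h1
  exact pos_of_mul_pos_right (by linarith) (h (k + 1)).1.le

lemma HasEdges.one_le_crossZ_pred (h : HasEdges P v m) (k : Fin (P.n + 3)) :
    1 ≤ crossZ (v (k - 1)) (v k) := by
  have := h.one_le_crossZ (k - 1)
  rwa [sub_add_cancel] at this

lemma edgeFun_relation (L : ℤ) (a b c : Fin (P.n + 3)) (q : Z2) :
    crossZ (v a) (v c) * edgeFun P v L b q =
      crossZ (v b) (v c) * edgeFun P v L a q + crossZ (v a) (v b) * edgeFun P v L c q -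
      L * (crossZ (v b) (v c) * edgeFun P v 1 a (P.vert b) +
        crossZ (v a) (v b) * edgeFun P v 1 c (P.vert b)) := by
  have := crossZ_plucker (v a) (v b) (v c) (q - L • P.vert b)
  rw [crossZ_sub_smul_vert, crossZ_sub_smul_vert, crossZ_sub_smul_vert, edgeFun_self] at this
  linarith

lemma HasEdges.not_both_small (h : HasEdges P v m) {H B L : ℤ} (hB : 0 ≤ B)
    (hH : ∀ a b, |crossZ (v a) (v b)| ≤ H) (hL : 3 * (H * B) < L) {q : Z2}
    (hq : ∀ k, 0 ≤ edgeFun P v L k q) {j l : Fin (P.n + 3)} (h1 : l ≠ j) (h2 : l ≠ j + 1)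
    (hj : edgeFun P v L j q < B) (hl : edgeFun P v L l q < B)
    (hjl : 0 ≤ crossZ (v j) (v l) ∨ edgeFun P v L (j + 1) q < B) : False := by
  have hH0 : 0 ≤ H := (abs_nonneg _).trans (hH j l)
  have hrel := edgeFun_relation (v := v) L j (j + 1) l q
  rw [h.edgeFun_succ, mul_zero, zero_add] at hrel
  have hZ := h.one_le_crossZ j
  have hh := h.one_le_edgeFun (k := l) (j := j + 1) h2.symm
    (fun h' => h1 (add_right_cancel h').symm)
  have hZh : 1 ≤ crossZ (v j) (v (j + 1)) * edgeFun P v 1 l (P.vert (j + 1)) := by nlinarith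
  have hmul : ∀ a b k, edgeFun P v L k q < B →
      |crossZ (v a) (v b) * edgeFun P v L k q| ≤ H * B := by
    intro a b k hk
    rw [abs_mul]
    refine mul_le_mul (hH a b) ?_ (abs_nonneg _) hH0
    rw [abs_of_nonneg (hq k)]
    exact hk.le
  have e1 := (abs_le.1 (hmul (j + 1) l j hj)).2
  have e2 := (abs_le.1 (hmul j (j + 1) l hl)).2
  have hHB : 0 ≤ H * B := mul_nonneg hH0 hB
  have e3 : -(H * B) ≤ crossZ (v j) (v l) * edgeFun P v L (j + 1) q := by
    rcases hjl with h3 | h3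
    · have := mul_nonneg h3 (hq (j + 1))
      linarith
    · exact (abs_le.1 (hmul j l (j + 1) h3)).1
  nlinarith

/-- In a large dilation of `P` a point is close to at most two edges, which are then adjacent. -/
lemma HasEdges.exists_corner (h : HasEdges P v m) {H B L : ℤ} (hB : 0 ≤ B)
    (hH : ∀ a b, |crossZ (v a) (v b)| ≤ H) (hL : 3 * (H * B) < L) {q : Z2}
    (hq : ∀ k, 0 ≤ edgeFun P v L k q) :
    ∃ k₀, ∀ k, k ≠ k₀ - 1 → k ≠ k₀ → B ≤ edgeFun P v L k q := by
  have pair : ∀ j l, edgeFun P v L j q < B → edgeFun P v L l q < B →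
      l ≠ j → l ≠ j + 1 → j ≠ l + 1 → False := by
    intro j l hj hl h1 h2 h3
    rcases le_total 0 (crossZ (v j) (v l)) with h4 | h4
    · exact h.not_both_small hB hH hL hq h1 h2 hj hl (Or.inl h4)
    · rw [crossZ_comm] at h4
      exact h.not_both_small hB hH hL hq h1.symm h3 hl hj (Or.inl (by linarith))
  by_contra hcon
  push Not at hcon
  obtain ⟨j, -, -, hj⟩ := hcon 0
  by_cases hj1 : edgeFun P v L (j + 1) q < B
  · obtain ⟨l, hl1, hl2, hl⟩ := hcon (j + 1)
    rw [add_sub_cancel_right] at hl1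
    by_cases hl3 : j = l + 1
    · rw [hl3] at hl2 hj1 hj hl1
      exact h.not_both_small hB hH hL hq (fun h' => hl2 h'.symm) (fin_add_one_ne _) hl hj1
        (Or.inr hj)
    · exact pair j l hj hl hl1 hl2 hl3
  · obtain ⟨l, hl1, hl2, hl⟩ := hcon j
    refine pair j l hj hl hl2 ?_ ?_
    · rintro rfl
      exact hj1 hl
    · rintro rfl
      exact hl1 (by rw [add_sub_cancel_right])

/-- The lattice points of the dilation of `P` by `M`, with the corners cut off along the level
curves of value `C`. -/
def window (P : IntPolygon) (v : Fin (P.n + 3) → Z2) (M C : ℤ) : Set Z2 :=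
  {f | ∀ k, 0 ≤ edgeFun P v M k f ∧
    C ≤ (edgeFun P v M (k - 1) f + 1) * (edgeFun P v M k f + 1)}

lemma mem_window_of_forall_ne {M C : ℤ} (hC : 1 ≤ C) {f : Z2} (i : Fin (P.n + 3))
    (hi : 0 ≤ edgeFun P v M i f) (h : ∀ k, k ≠ i → C ≤ edgeFun P v M k f + 1) :
    f ∈ window P v M C := by
  have hnn : ∀ k, 0 ≤ edgeFun P v M k f := by
    intro k
    by_cases hk : k = i
    · rwa [hk]
    · linarith [h k hk]
  intro k
  refine ⟨hnn k, ?_⟩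
  by_cases hk : k = i
  · have h1 := h (k - 1) (by rw [hk]; exact fin_sub_one_ne i)
    have h2 := hnn k
    nlinarith
  · have h1 := h k hk
    have h2 := hnn (k - 1)
    nlinarith

lemma HasEdges.sum_mul_crossZ (h : HasEdges P v m) (p : Z2) : ∑ k, m k * crossZ (v k) p = 0 := by
  have h1 : ∀ k, m k * crossZ (v k) p =
      crossZ (P.vert (k + 1)) p - crossZ (P.vert k) p := by
    intro k
    rw [← crossZ_smul_left, ← (h k).2, IntPolygon.edgeVec]
    simp only [crossZ, Prod.fst_sub, Prod.snd_sub]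
    ring
  simp only [h1]
  rw [Finset.sum_sub_distrib, sub_eq_zero]
  exact Equiv.sum_comp (Equiv.addRight (1 : Fin (P.n + 3))) fun k => crossZ (P.vert k) p

lemma HasEdges.finite_window (h : HasEdges P v m) (M C : ℤ) : (window P v M C).Finite := by
  set c : ℤ := -(∑ k, m k * crossZ (v k) (M • P.vert k)) with hc
  have hle : ∀ f ∈ window P v M C, ∀ k, edgeFun P v M k f ≤ c := by
    intro f hf k
    have h1 : ∑ k, m k * edgeFun P v M k f = c := by
      simp only [edgeFun, crossZ_sub_right, mul_sub, Finset.sum_sub_distrib, h.sum_mul_crossZ, hc]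
      ring
    have h2 : m k * edgeFun P v M k f ≤ ∑ k, m k * edgeFun P v M k f :=
      Finset.single_le_sum (f := fun k => m k * edgeFun P v M k f)
        (fun k _ => mul_nonneg (h k).1.le (hf k).1) (Finset.mem_univ k)
    have h3 := (hf k).1
    have h4 := (h k).1
    nlinarith
  refine Set.Finite.of_finite_image (f := fun f => (edgeFun P v M 0 f, edgeFun P v M (0 + 1) f))
    (((Set.finite_Icc 0 c).prod (Set.finite_Icc 0 c)).subset ?_) ?_
  · rintro _ ⟨f, hf, rfl⟩
    exact ⟨⟨(hf _).1, hle f hf _⟩, ⟨(hf _).1, hle f hf _⟩⟩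
  · intro f _ f' _ hff
    have hδ := h.one_le_crossZ 0
    simp only [edgeFun, crossZ_sub_right, Prod.mk.injEq, sub_left_inj] at hff
    obtain ⟨h1, h2⟩ := hff
    set a := v 0
    set b := v (0 + 1)
    simp only [crossZ] at h1 h2 hδ
    have e1 : (a.1 * b.2 - a.2 * b.1) * (f.1 - f'.1) = 0 := by
      linear_combination b.1 * h1 - a.1 * h2
    have e2 : (a.1 * b.2 - a.2 * b.1) * (f.2 - f'.2) = 0 := by
      linear_combination b.2 * h1 - a.2 * h2
    have hne : a.1 * b.2 - a.2 * b.1 ≠ 0 := by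
      intro h0
      rw [h0] at hδ
      linarith
    exact Prod.ext (sub_eq_zero.1 ((mul_eq_zero.1 e1).resolve_left hne))
      (sub_eq_zero.1 ((mul_eq_zero.1 e2).resolve_left hne))

lemma HasEdges.window_nonempty (h : HasEdges P v m) {K C : ℤ} (hC : 1 ≤ C) (hK : C ≤ K) :
    (window P v ((P.n + 3 : ℕ) * K) C).Nonempty := by
  refine ⟨K • ∑ j, P.vert j, ?_⟩
  have hs : ∀ k, K ≤ edgeFun P v ((P.n + 3 : ℕ) * K) k (K • ∑ j, P.vert j) := by
    intro k
    have h1 : ∀ s : Finset (Fin (P.n + 3)),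
        crossZ (v k) (∑ j ∈ s, P.vert j) = ∑ j ∈ s, crossZ (v k) (P.vert j) := by
      intro s
      induction s using Finset.cons_induction with
      | empty => simp [crossZ_zero_right]
      | cons a s ha ih => rw [Finset.sum_cons, Finset.sum_cons, crossZ_add_right, ih]
    have h2 : edgeFun P v ((P.n + 3 : ℕ) * K) k (K • ∑ j, P.vert j) =
        K * ∑ j, edgeFun P v 1 k (P.vert j) := by
      simp only [edgeFun, crossZ_sub_right, crossZ_smul_right, h1, Finset.sum_sub_distrib,
        Finset.sum_const, Finset.card_univ, Fintype.card_fin, nsmul_eq_mul]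
      ring
    have h3 : edgeFun P v 1 k (P.vert (k + 1 + 1)) ≤ ∑ j, edgeFun P v 1 k (P.vert j) :=
      Finset.single_le_sum (f := fun j => edgeFun P v 1 k (P.vert j))
        (fun j _ => h.edgeFun_nonneg k j) (Finset.mem_univ _)
    have h4 := h.one_le_edgeFun (k := k) (j := k + 1 + 1) (fin_add_two_ne k) (fin_add_one_ne _)
    rw [h2]
    nlinarith
  exact mem_window_of_forall_ne hC 0 (by linarith [hs 0]) fun k _ => by linarith [hs k]

/-- Lattice points of `P`, other than the vertex `i`, used to code that vertex. -/
def vertexNeighbours (P : IntPolygon) (v : Fin (P.n + 3) → Z2) (i : Fin (P.n + 3)) : Set Z2 :=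
  {w | w ≠ P.vert i ∧
    (w ∈ Set.range P.vert ∨ w = P.vert i - v (i - 1) ∨ w = P.vert i + v i)}

lemma HasEdges.vert_injective (h : HasEdges P v m) : Function.Injective P.vert := by
  intro j k hjk
  by_contra hne
  by_cases h2 : j = k + 1
  · have h3 := h.one_le_edgeFun (k := k + 1) (j := k) (fin_add_one_ne k).symm
      (fin_add_two_ne k).symm
    rw [← hjk, h2, edgeFun_self] at h3
    linarith
  · have h3 := h.one_le_edgeFun hne h2
    rw [hjk, edgeFun_self] at h3
    linarith

lemma HasEdges.exists_neighbour (h : HasEdges P v m) {H C M : ℤ} (hC : 1 ≤ C)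
    (hH : ∀ a b, |crossZ (v a) (v b)| ≤ H) (hH' : ∀ k j, edgeFun P v 1 k (P.vert j) ≤ H)
    (hM : 3 * (H * (C + 2 * H)) ≤ M) {q : Z2} (i : Fin (P.n + 3))
    (hq : ∀ k, 0 ≤ edgeFun P v (M + 1) k q)
    (hqC : ∀ k, C ≤ (edgeFun P v (M + 1) (k - 1) q + 1) * (edgeFun P v (M + 1) k q + 1))
    (hqi : (C + H) ^ 2 ≤
      (edgeFun P v (M + 1) (i - 1) q + 1) * (edgeFun P v (M + 1) i q + 1)) :
    ∃ s ∈ vertexNeighbours P v i, q - s ∈ window P v M C := by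
  have hH0 : 0 ≤ H := (abs_nonneg _).trans (hH i i)
  obtain ⟨k₀, hk₀⟩ := h.exists_corner (B := C + 2 * H) (by linarith) hH
    (L := M + 1) (by linarith) hq
  by_cases hki : k₀ = i
  · subst hki
    set k := k₀
    have hδ := h.one_le_crossZ_pred k
    have hδH := (abs_le.1 (hH (k - 1) k)).2
    by_cases hbig : C + H ≤ edgeFun P v (M + 1) k q + 1
    · refine ⟨P.vert k - v (k - 1), ⟨?_, Or.inr (Or.inl rfl)⟩, ?_⟩
      · rw [Ne, sub_eq_self]
        intro h0
        rw [h0] at hδ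
        simp [crossZ] at hδ
      · have hE : ∀ j, edgeFun P v M j (q - (P.vert k - v (k - 1))) =
            edgeFun P v (M + 1) j q - (edgeFun P v 1 j (P.vert k) - crossZ (v j) (v (k - 1))) := by
          intro j
          rw [edgeFun_sub M 1, sub_eq_add_neg (P.vert k), edgeFun_add, crossZ_neg_right]
          ring
        refine mem_window_of_forall_ne hC (k - 1) ?_ fun j hj => ?_
        · rw [hE, h.edgeFun_pred, crossZ_self]
          linarith [hq (k - 1)]
        · rw [hE]
          by_cases hjk : j = k
          · rw [hjk, edgeFun_self, crossZ_comm]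
            linarith
          · have h1 := hk₀ j hj hjk
            have h2 := hH' j k
            have h3 := (abs_le.1 (hH j (k - 1))).1
            linarith
    · have hbig' : C + H ≤ edgeFun P v (M + 1) (k - 1) q + 1 := by
        by_contra hlt
        push Not at hbig hlt
        have h1 := hq k
        have h2 := hq (k - 1)
        have h3 : (edgeFun P v (M + 1) (k - 1) q + 1) * (edgeFun P v (M + 1) k q + 1) <
            (C + H) * (C + H) := mul_lt_mul'' hlt hbig (by linarith) (by linarith)
        nlinarith
      refine ⟨P.vert k + v k, ⟨?_, Or.inr (Or.inr rfl)⟩, ?_⟩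
      · rw [Ne, add_eq_left]
        intro h0
        rw [h0] at hδ
        simp [crossZ] at hδ
      · have hE : ∀ j, edgeFun P v M j (q - (P.vert k + v k)) =
            edgeFun P v (M + 1) j q - (edgeFun P v 1 j (P.vert k) + crossZ (v j) (v k)) := by
          intro j
          rw [edgeFun_sub M 1, edgeFun_add]
        refine mem_window_of_forall_ne hC k ?_ fun j hj => ?_
        · rw [hE, edgeFun_self, crossZ_self]
          linarith [hq k]
        · rw [hE]
          by_cases hjk : j = k - 1
          · rw [hjk, h.edgeFun_pred]
            linarith
          · have h1 := hk₀ j hjk hj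
            have h2 := hH' j k
            have h3 := (abs_le.1 (hH j k)).2
            linarith
  · refine ⟨P.vert k₀, ⟨fun h' => hki (h.vert_injective h'), Or.inl ⟨k₀, rfl⟩⟩, ?_⟩
    have hE : ∀ j, edgeFun P v M j (q - P.vert k₀) =
        edgeFun P v (M + 1) j q - edgeFun P v 1 j (P.vert k₀) := fun j => edgeFun_sub M 1 j q _
    have hz : ∀ j, (edgeFun P v 1 j (P.vert k₀) = 0) ∨
        C ≤ edgeFun P v M j (q - P.vert k₀) := by
      intro j
      by_cases h1 : j = k₀ - 1
      · left
        rw [h1, h.edgeFun_pred]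
      by_cases h2 : j = k₀
      · left
        rw [h2, edgeFun_self]
      right
      rw [hE]
      linarith [hk₀ j h1 h2, hH' j k₀]
    have hnn : ∀ j, 0 ≤ edgeFun P v M j (q - P.vert k₀) := by
      intro j
      rcases hz j with h1 | h1
      · rw [hE, h1]
        linarith [hq j]
      · linarith
    intro j
    refine ⟨hnn j, ?_⟩
    have h3 := hnn j
    have h4 := hnn (j - 1)
    rcases hz j with h1 | h1
    · rcases hz (j - 1) with h2 | h2
      · rw [hE, hE, h1, h2, sub_zero, sub_zero]
        exact hqC j
      · nlinarith
    · nlinarith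

/-- A large window codes itself across every corner at which `X` is locally coding. -/
lemma HasEdges.exists_window (h : HasEdges P v m) {A : Type*} {X : Set (Config A)}
    (hX : IsSubshift X) (I : Set (Fin (P.n + 3)))
    (hI : ∀ i ∈ I, ∃ r C : ℤ, LocalCornerCoding X (v (i - 1)) (v i) r C) :
    ∃ F : Set Z2, F.Finite ∧ F.Nonempty ∧ ∀ i ∈ I,
      CodesZ X {p | ∃ s ∈ vertexNeighbours P v i, p - s ∈ F} {p | p - P.vert i ∈ F} := by
  obtain ⟨r, C, hC, hloc⟩ : ∃ r C : ℤ, 1 ≤ C ∧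
      ∀ i ∈ I, LocalCornerCoding X (v (i - 1)) (v i) r C := by
    choose r C hrC using fun i : I => hI i i.2
    obtain ⟨r', hr'⟩ := Finite.exists_le r
    obtain ⟨C', hC'⟩ := Finite.exists_le C
    exact ⟨r', max C' 1, le_max_right _ _, fun i hi =>
      (hrC ⟨i, hi⟩).mono (hr' _) (le_max_of_le_left (hC' _))⟩
  obtain ⟨H, hH, hH'⟩ : ∃ H : ℤ, (∀ a b, |crossZ (v a) (v b)| ≤ H) ∧
      ∀ k j, edgeFun P v 1 k (P.vert j) ≤ H := by
    obtain ⟨H₁, h₁⟩ := Finite.exists_le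
      fun z : Fin (P.n + 3) × Fin (P.n + 3) => |crossZ (v z.1) (v z.2)|
    obtain ⟨H₂, h₂⟩ := Finite.exists_le
      fun z : Fin (P.n + 3) × Fin (P.n + 3) => edgeFun P v 1 z.1 (P.vert z.2)
    exact ⟨max H₁ H₂, fun a b => le_max_of_le_left (h₁ (a, b)),
      fun k j => le_max_of_le_right (h₂ (k, j))⟩
  have hH0 : 0 ≤ H := (abs_nonneg _).trans (hH 0 0)
  set R : ℤ := |(C + H) ^ 2 + r| with hR
  have hR0 : 0 ≤ R := abs_nonneg _
  have hHB : 0 ≤ H * (C + 2 * H) := by positivity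
  have hHR : 0 ≤ H * R := by positivity
  set K : ℤ := C + 2 * H + 3 * (H * (C + 2 * H)) + 2 * (H * R) with hK
  set M : ℤ := (P.n + 3 : ℕ) * K with hM
  have hKM : K ≤ M := by
    have : (1 : ℤ) ≤ (P.n + 3 : ℕ) := by
      push_cast
      linarith [Int.natCast_nonneg P.n]
    nlinarith
  refine ⟨window P v M C, h.finite_window M C, h.window_nonempty hC (by linarith), ?_⟩
  intro i hi
  have hcover : ∀ q : Z2, (∀ k, 0 ≤ edgeFun P v (M + 1) k q) →
      (∀ k, C ≤ (edgeFun P v (M + 1) (k - 1) q + 1) * (edgeFun P v (M + 1) k q + 1)) →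
      (C + H) ^ 2 ≤ (edgeFun P v (M + 1) (i - 1) q + 1) * (edgeFun P v (M + 1) i q + 1) →
      q ∈ {p | ∃ s ∈ vertexNeighbours P v i, p - s ∈ window P v M C} :=
    fun q h1 h2 h3 => h.exists_neighbour hC hH hH' (by linarith) i h1 h2 h3
  set W := (M + 1) • P.vert i with hW
  have hcoord : ∀ q, crossZ (v i) q = edgeFun P v (M + 1) i (W + q) ∧
      crossZ (v (i - 1)) q = edgeFun P v (M + 1) (i - 1) (W + q) := by
    intro q
    have h1 := crossZ_sub_smul_vert (v := v) (M + 1) i i (W + q)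
    have h2 := crossZ_sub_smul_vert (v := v) (M + 1) (i - 1) i (W + q)
    rw [← hW, add_sub_cancel_left] at h1 h2
    rw [h1, h2, edgeFun_self, h.edgeFun_pred]
    simp
  have hlevel : ∀ q, cornerLevel (v (i - 1)) (v i) q =
      (edgeFun P v (M + 1) (i - 1) (W + q) + 1) * (edgeFun P v (M + 1) i (W + q) + 1) := by
    intro q
    rw [cornerLevel, (hcoord q).1, (hcoord q).2, mul_comm]
  refine CodesZ.of_forall fun q hq => ?_
  have hE : ∀ k, edgeFun P v M k (q - P.vert i) + edgeFun P v 1 k (P.vert i) =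
      edgeFun P v (M + 1) k q := by
    intro k
    rw [edgeFun_sub M 1]
    ring
  have hge : ∀ k, edgeFun P v M k (q - P.vert i) ≤ edgeFun P v (M + 1) k q := by
    intro k
    rw [← hE]
    linarith [h.edgeFun_nonneg k i]
  have hqnn : ∀ k, 0 ≤ edgeFun P v (M + 1) k q := fun k => ((hq k).1).trans (hge k)
  have hqC : ∀ k, C ≤ (edgeFun P v (M + 1) (k - 1) q + 1) * (edgeFun P v (M + 1) k q + 1) := by
    intro k
    refine (hq k).2.trans (mul_le_mul ?_ ?_ ?_ ?_)
    · linarith [hge (k - 1)]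
    · linarith [hge k]
    · linarith [(hq k).1]
    · linarith [hqnn (k - 1)]
  have hqW : W + (q - W) = q := by abel
  by_cases hlarge : (C + H) ^ 2 ≤
      (edgeFun P v (M + 1) (i - 1) q + 1) * (edgeFun P v (M + 1) i q + 1)
  · exact CodesZ.of_subset (Set.singleton_subset_iff.2 (hcover q hqnn hqC hlarge))
  have hfin := (hloc i hi).codesZ hX W ((C + H) ^ 2)
    {p | ∃ s ∈ vertexNeighbours P v i, p - s ∈ window P v M C} ?_ (q - W)
    (by rw [(hcoord _).2, hqW]; exact hqnn _) (by rw [(hcoord _).1, hqW]; exact hqnn _)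
    (by rw [hlevel, hqW]; exact hqC i) (by rw [hlevel, hqW]; exact not_le.1 hlarge)
  · rwa [hqW] at hfin
  · intro p hp1 hp2 hp3 hp4 hp5
    have hp4' : crossZ (v (i - 1)) p ≤ R := hp4.trans (le_abs_self _)
    have hp5' : crossZ (v i) p ≤ R := hp5.trans (le_abs_self _)
    have hfar : ∀ k, k ≠ i - 1 → k ≠ i → C ≤ edgeFun P v (M + 1) k (W + p) := by
      intro k hk1 hk2
      have h1 := h.one_le_edgeFun (k := k) (j := i) hk2.symm
        (fun h' => hk1 (by rw [h', add_sub_cancel_right]))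
      have h2 := crossZ_sub_smul_vert (v := v) (M + 1) k i (W + p)
      rw [← hW, add_sub_cancel_left] at h2
      have h3 := crossZ_plucker (v (i - 1)) (v k) (v i) p
      have hδ := h.one_le_crossZ_pred i
      have h4 : -(H * R) ≤ crossZ (v k) (v i) * crossZ (v (i - 1)) p := by
        have := (abs_le.1 (hH k i)).1
        nlinarith
      have h5 : -(H * R) ≤ crossZ (v (i - 1)) (v k) * crossZ (v i) p := by
        have := (abs_le.1 (hH (i - 1) k)).1
        nlinarith
      have h6 : -(2 * (H * R)) ≤ crossZ (v k) p := by
        by_contra hlt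
        push Not at hlt
        nlinarith
      have h7 : M + 1 ≤ (M + 1) * edgeFun P v 1 k (P.vert i) := by nlinarith
      linarith
    have hnn : ∀ k, 0 ≤ edgeFun P v (M + 1) k (W + p) := by
      intro k
      by_cases hk1 : k = i - 1
      · rw [hk1, ← (hcoord p).2]
        exact hp1
      by_cases hk2 : k = i
      · rw [hk2, ← (hcoord p).1]
        exact hp2
      linarith [hfar k hk1 hk2]
    rw [hlevel] at hp3
    refine hcover _ hnn (fun k => ?_) hp3
    have h3 := hnn k
    have h4 := hnn (k - 1)
    by_cases hk2 : k = i
    · rw [hk2]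
      nlinarith
    by_cases hk1 : k = i - 1
    · have h5 := hfar (k - 1) (by rw [hk1]; exact fin_sub_one_ne _) (by
        rw [hk1]
        intro h'
        have := fin_add_two_ne (i - 1 - 1)
        rw [sub_add_cancel, sub_add_cancel] at this
        exact this h'.symm)
      nlinarith
    · have h5 := hfar k hk1 hk2
      nlinarith

end Window

section Column

variable {A : Type*}

/-- The unimodular parallelogram spanned by `u` and `t`. -/
def parallelogram (u t : Z2) (h : crossZ u t = 1) : IntPolygon where
  n := 1
  vert := ![0, u, u + t, t]
  convex := by
    simp only [crossZ] at h
    intro i j h1 h2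
    fin_cases i <;> fin_cases j <;> simp [crossZ] at * <;> linarith

lemma hasEdges_parallelogram {u t : Z2} (h : crossZ u t = 1) :
    HasEdges (parallelogram u t h) ![u, t, -u, -t] 1 := by
  intro i
  refine ⟨one_pos, ?_⟩
  have key : ∀ i : Fin 4, (![0, u, u + t, t] : Fin 4 → Z2) (i + 1) -
      (![0, u, u + t, t] : Fin 4 → Z2) i = (1 : ℤ) • (![u, t, -u, -t] : Fin 4 → Z2) i := by
    intro i
    rw [one_smul]
    fin_cases i
    · exact sub_zero u
    · exact add_sub_cancel_left u t
    · change t - (u + t) = -u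
      abel
    · exact zero_sub t
  exact key i

lemma exists_parallelogram_window [Finite A] {X : Set (Config A)} (hX : IsSubshift X) {u t : Z2}
    (h : crossZ u t = 1) (I : Set (Fin 4))
    (hI : ∀ i ∈ I, ∃ r C, LocalCornerCoding X
      ((![u, t, -u, -t] : Fin 4 → Z2) (i - 1)) ((![u, t, -u, -t] : Fin 4 → Z2) i) r C) :
    ∃ F : Set Z2, F.Finite ∧ F.Nonempty ∧ ∀ i ∈ I,
      CodesZ X {p | ∃ j, j ≠ i ∧ p - (![0, u, u + t, t] : Fin 4 → Z2) j ∈ F}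
        {p | p - (![0, u, u + t, t] : Fin 4 → Z2) i ∈ F} := by
  obtain ⟨F, hF, hne, hc⟩ := (hasEdges_parallelogram h).exists_window hX I hI
  refine ⟨F, hF, hne, fun i hi => (hc i hi).mono ?_ subset_rfl⟩
  rintro p ⟨s, ⟨hs1, hs2⟩, hs3⟩
  have key : ∃ j, (![0, u, u + t, t] : Fin 4 → Z2) j = s := by
    have hedge : ∀ j : Fin 4, (![0, u, u + t, t] : Fin 4 → Z2) (j + 1) -
        (![0, u, u + t, t] : Fin 4 → Z2) j = (![u, t, -u, -t] : Fin 4 → Z2) j := by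
      intro j
      exact (hasEdges_parallelogram h j).2.trans (one_smul ℤ _)
    rcases hs2 with ⟨j, rfl⟩ | rfl | rfl
    · exact ⟨j, rfl⟩
    · refine ⟨i - 1, ?_⟩
      have := hedge (i - 1)
      rw [sub_add_cancel] at this
      exact (sub_eq_of_eq_add' (sub_eq_iff_eq_add.1 this)).symm
    · exact ⟨i + 1, (sub_eq_iff_eq_add'.1 (hedge i))⟩
  obtain ⟨j, rfl⟩ := key
  refine ⟨j, ?_, hs3⟩
  rintro rfl
  exact hs1 rfl

/-- The union of the translates of `F` by `i u + j t` for `0 ≤ i ≤ r` and `|j| ≤ r`. -/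
def slab (u t : Z2) (F : Set Z2) (r : ℤ) : Set Z2 :=
  {p | ∃ i j : ℤ, 0 ≤ i ∧ i ≤ r ∧ |j| ≤ r ∧ p - (i • u + j • t) ∈ F}

lemma slab_finite (u t : Z2) {F : Set Z2} (hF : F.Finite) (r : ℤ) : (slab u t F r).Finite := by
  have h : ((Set.Icc (0 : ℤ) r ×ˢ Set.Icc (-r) r) ×ˢ F).Finite :=
    ((Set.finite_Icc _ _).prod (Set.finite_Icc _ _)).prod hF
  refine (h.image fun a => a.2 + (a.1.1 • u + a.1.2 • t)).subset ?_
  rintro p ⟨i, j, h1, h2, h3, h4⟩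
  exact ⟨((i, j), p - (i • u + j • t)), ⟨⟨⟨h1, h2⟩, abs_le.1 h3⟩, h4⟩, sub_add_cancel _ _⟩

lemma subset_slab (u t : Z2) {F : Set Z2} {r : ℤ} (hr : 0 ≤ r) : F ⊆ slab u t F r :=
  fun p hp => ⟨0, 0, le_rfl, hr, by simpa using hr, by simpa using hp⟩

lemma eq_smul_add_smul {u t : Z2} (h : crossZ u t = 1) (p : Z2) :
    p = crossZ p t • u + crossZ u p • t := by
  simp only [crossZ] at *
  ext
  · simp only [Prod.fst_add, Prod.smul_fst, smul_eq_mul]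
    linear_combination -p.1 * h
  · simp only [Prod.snd_add, Prod.smul_snd, smul_eq_mul]
    linear_combination -p.2 * h

lemma exists_slab_codes [Finite A] {X : Set (Config A)} (hX : IsSubshift X) {u t : Z2}
    (h : crossZ u t = 1) {F : Set Z2} (hF : F.Finite) (hne : F.Nonempty)
    (hexp : ExpansiveRay X (toR2 (-t)))
    (h0 : CodesZ X {p | p - u ∈ F ∨ p - (u + t) ∈ F ∨ p - t ∈ F} F)
    (h3 : CodesZ X {p | p ∈ F ∨ p - u ∈ F ∨ p - (u + t) ∈ F} {p | p - t ∈ F}) :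
    ∃ r₀ : ℤ, 0 ≤ r₀ ∧ ∀ r, r₀ ≤ r → CodesZ X (slab u t F r) {p | p + u ∈ slab u t F r} := by
  obtain ⟨f, hf⟩ := hne
  have ht : toR2 (-t) ≠ 0 := by
    intro h'
    have h1 : ((-t).1 : ℝ) = 0 := congrArg Prod.fst h'
    have h2 : ((-t).2 : ℝ) = 0 := congrArg Prod.snd h'
    rw [Int.cast_eq_zero] at h1 h2
    rw [Prod.fst_neg, neg_eq_zero] at h1
    rw [Prod.snd_neg, neg_eq_zero] at h2
    simp [crossZ, h1, h2] at h
  have hT : {p | p + u ∈ F}.Finite := by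
    refine (hF.image fun p => p - u).subset fun p hp => ⟨p + u, hp, add_sub_cancel_right _ _⟩
  obtain ⟨S, hSf, hS, hc⟩ := CodesZ.exists_finite hX hT
    ((hexp.codesZ_halfPlane hX ht (crossR (toR2 (-t)) (toR2 f))).mono subset_rfl
      (Set.subset_univ _))
  obtain ⟨b, hb0, hb⟩ := exists_crossZ_bound (hSf.image fun p => p - f) u t
  refine ⟨b, hb0, fun r hr => ?_⟩
  have hr0 : 0 ≤ r := hb0.trans hr
  have hbase : CodesZ X (slab u t F r) {p | p + u ∈ F} := by
    refine hc.mono (fun p hp => ?_) subset_rfl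
    have h1 := hb _ ⟨p, hp, rfl⟩
    have h2 : crossZ (-t) f ≤ crossZ (-t) p := by
      have := hS hp
      simp only [Set.mem_ofPred_eq, crossR, toR2] at this
      simp only [crossZ]
      exact_mod_cast this
    have h4 : crossZ (p - f) t = - crossZ t (p - f) := crossZ_comm _ _
    have h5 := crossZ_sub_right (-t) p f
    rw [crossZ_neg_left] at h5
    refine ⟨crossZ (p - f) t, crossZ u (p - f), by linarith, ?_, h1.1.trans hr, ?_⟩
    · linarith [neg_le_abs (crossZ t (p - f)), h1.2]
    · rw [← eq_smul_add_smul h, sub_sub_cancel]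
      exact hf
  have hslab : ∀ (i j : ℤ) (p : Z2), 0 ≤ i → i ≤ r → |j| ≤ r → p - (i • u + j • t) ∈ F →
      p ∈ slab u t F r := fun i j p a1 a2 a3 a4 => ⟨i, j, a1, a2, a3, a4⟩
  have hup : ∀ n : ℕ, (n : ℤ) ≤ r → CodesZ X (slab u t F r) {p | p + u - (n : ℤ) • t ∈ F} := by
    intro n
    induction n with
    | zero => simpa using fun _ => hbase
    | succ n ih =>
      intro hn
      push_cast at hn ⊢
      have ih' := ih (by linarith)
      refine CodesZ.trans (T := slab u t F r ∪ {p | p + u - (n : ℤ) • t ∈ F}) ?_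
        (h3.shift hX (-u + (n : ℤ) • t) ?_ ?_)
      · rintro x hx x' hx' hp p (hp1 | hp1)
        · exact hp p hp1
        · exact ih' x hx x' hx' hp p hp1
      · rintro p (hp | hp | hp)
        · right
          rw [Set.mem_ofPred_eq]
          convert hp using 1
          abel
        · left
          refine hslab 0 n _ le_rfl hr0 (by rw [Nat.abs_cast]; linarith) ?_
          convert hp using 1
          rw [zero_smul]
          abel
        · left
          refine hslab 0 (n + 1) _ le_rfl hr0 (by rw [abs_of_nonneg (by positivity)]; linarith) ?_
          convert hp using 1
          rw [zero_smul, add_smul, one_smul]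
          abel
      · intro p hp
        rw [Set.mem_ofPred_eq] at hp ⊢
        convert hp using 1
        rw [add_smul, one_smul]
        abel
  have hdown : ∀ n : ℕ, (n : ℤ) ≤ r → CodesZ X (slab u t F r) {p | p + u + (n : ℤ) • t ∈ F} := by
    intro n
    induction n with
    | zero => simpa using fun _ => hbase
    | succ n ih =>
      intro hn
      push_cast at hn ⊢
      have ih' := ih (by linarith)
      refine CodesZ.trans (T := slab u t F r ∪ {p | p + u + (n : ℤ) • t ∈ F}) ?_
        (h0.shift hX (-u - ((n : ℤ) + 1) • t) ?_ ?_)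
      · rintro x hx x' hx' hp p (hp1 | hp1)
        · exact hp p hp1
        · exact ih' x hx x' hx' hp p hp1
      · rintro p (hp | hp | hp)
        · left
          refine hslab 0 (-(n + 1)) _ le_rfl hr0
            (by rw [abs_neg, abs_of_nonneg (by positivity)]; linarith) ?_
          convert hp using 1
          rw [zero_smul, neg_smul]
          abel
        · left
          refine hslab 0 (-n) _ le_rfl hr0 (by rw [abs_neg, Nat.abs_cast]; linarith) ?_
          convert hp using 1
          rw [zero_smul, neg_smul, add_smul, one_smul]
          abel
        · right
          rw [Set.mem_ofPred_eq]
          convert hp using 1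
          rw [add_smul, one_smul]
          abel
      · intro p hp
        rw [Set.mem_ofPred_eq] at hp
        convert hp using 1
        abel
  rintro x hx x' hx' hp p ⟨i, j, hi0, hir, hj, hpF⟩
  rcases hi0.eq_or_lt with rfl | hi
  · rcases le_total 0 j with hj0 | hj0
    · lift j to ℕ using hj0
      refine hup j ((le_abs_self _).trans hj) x hx x' hx' hp p ?_
      rw [Set.mem_ofPred_eq]
      convert hpF using 1
      rw [zero_smul, zero_add]
    · obtain ⟨n, rfl⟩ : ∃ n : ℕ, j = -n := ⟨j.natAbs, by omega⟩
      refine hdown n ((le_abs_self _).trans (by rwa [abs_neg] at hj)) x hx x' hx' hp p ?_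
      rw [Set.mem_ofPred_eq]
      convert hpF using 1
      rw [zero_smul, zero_add, neg_smul]
      abel
  · refine hp p (hslab (i - 1) j p (by omega) (by omega) hj ?_)
    convert hpF using 1
    rw [sub_smul, one_smul]
    abel

end Column

section Balance

lemma exists_crossZ_eq_one {v : Z2} (hv : Int.gcd v.1 v.2 = 1) : ∃ t, crossZ v t = 1 := by
  refine ⟨(-Int.gcdB v.1 v.2, Int.gcdA v.1 v.2), ?_⟩
  have := Int.gcd_eq_gcd_ab v.1 v.2
  rw [hv] at this
  simp only [crossZ]
  push_cast at this
  linarith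

lemma gcd_eq_one_of_crossZ_eq_one {v t : Z2} (h : crossZ v t = 1) : Int.gcd v.1 v.2 = 1 := by
  have h1 : ((Int.gcd v.1 v.2 : ℕ) : ℤ) ∣ crossZ v t :=
    dvd_sub ((Int.gcd_dvd_left _ _).mul_right _) ((Int.gcd_dvd_right _ _).mul_right _)
  rw [h] at h1
  exact_mod_cast Int.eq_one_of_dvd_one (by positivity) h1

lemma gcd_neg {v : Z2} (h : Int.gcd v.1 v.2 = 1) : Int.gcd (-v).1 (-v).2 = 1 := by
  simpa using h

lemma eq_or_eq_neg_of_crossZ_eq_zero {v w : Z2} (hv : Int.gcd v.1 v.2 = 1)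
    (hw : Int.gcd w.1 w.2 = 1) (h : crossZ v w = 0) : w = v ∨ w = -v := by
  obtain ⟨t, ht⟩ := exists_crossZ_eq_one hv
  have h1 := eq_smul_add_smul ht w
  rw [h, zero_smul, add_zero] at h1
  obtain ⟨t', ht'⟩ := exists_crossZ_eq_one hw
  rw [h1, crossZ_smul_left] at ht'
  rcases Int.eq_one_or_neg_one_of_mul_eq_one ht' with h2 | h2
  · left
    rw [h1, h2, one_smul]
  · right
    rw [h1, h2, neg_one_smul]

lemma toR2_ne_zero {v : Z2} (hv : v ≠ 0) : toR2 v ≠ 0 := by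
  intro h
  have h1 : (v.1 : ℝ) = 0 := congrArg Prod.fst h
  have h2 : (v.2 : ℝ) = 0 := congrArg Prod.snd h
  exact hv (Prod.ext (by exact_mod_cast h1) (by exact_mod_cast h2))

lemma ne_zero_of_gcd {v : Z2} (hv : Int.gcd v.1 v.2 = 1) : v ≠ 0 := by
  rintro rfl
  simp at hv

lemma toR2_neg (v : Z2) : toR2 (-v) = -toR2 v := by
  simp [toR2]

lemma toR2_smul (m : ℤ) (v : Z2) : toR2 (m • v) = (m : ℝ) • toR2 v := by
  simp [toR2]

lemma toR2_add (v w : Z2) : toR2 (v + w) = toR2 v + toR2 w := by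
  simp [toR2]

lemma toR2_sub (v w : Z2) : toR2 (v - w) = toR2 v - toR2 w := by
  simp [toR2]

lemma crossR_toR2 (v w : Z2) : crossR (toR2 v) (toR2 w) = crossZ v w := by
  simp [crossR, toR2, crossZ]

lemma crossR_add_right (a b c : ℝ × ℝ) : crossR a (b + c) = crossR a b + crossR a c := by
  simp only [crossR, Prod.fst_add, Prod.snd_add]
  ring

lemma crossR_smul_right (s : ℝ) (a b : ℝ × ℝ) : crossR a (s • b) = s * crossR a b := by
  simp only [crossR, Prod.smul_fst, Prod.smul_snd, smul_eq_mul]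
  ring

lemma eq_of_sameRay {v w : Z2} (hv : Int.gcd v.1 v.2 = 1)
    (hw : Int.gcd w.1 w.2 = 1) (h : SameRay ℝ (toR2 v) (toR2 w)) : w = v := by
  have hv0 := ne_zero_of_gcd hv
  obtain ⟨c, -, hc⟩ := h.exists_nonneg_left (toR2_ne_zero hv0)
  have h1 : crossZ v w = 0 := by
    have : (crossZ v w : ℝ) = 0 := by
      rw [← crossR_toR2, ← hc, crossR_smul_right, crossR_toR2, crossZ_self]
      simp
    exact_mod_cast this
  refine (eq_or_eq_neg_of_crossZ_eq_zero hv hw h1).resolve_right fun h2 => ?_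
  rw [h2, toR2_neg] at h
  exact toR2_ne_zero hv0 (eq_zero_of_sameRay_self_neg h)

variable {A : Type*} {X : Set (Config A)} {D : Finset Z2}

lemma NonexpansiveDirSet.expansiveRay (hD : NonexpansiveDirSet X D) {d : ℝ × ℝ} (hd : d ≠ 0)
    (h : ∀ v ∈ D, ∀ c : ℝ, 0 < c → d ≠ c • toR2 v) : ExpansiveRay X d := by
  by_contra hcon
  obtain ⟨v, hv, hvd⟩ := hD.2.2 d hd hcon
  obtain ⟨c, hc, hcd⟩ := hvd.exists_pos_left (toR2_ne_zero (ne_zero_of_gcd (hD.1 v hv))) hd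
  exact h v hv c hc hcd.symm

lemma NonexpansiveDirSet.expansiveRay_of_crossR_neg (hD : NonexpansiveDirSet X D) {u : Z2}
    (hu : ∀ v ∈ D, 0 ≤ crossZ u v) {d : ℝ × ℝ} (hd : crossR (toR2 u) d < 0) :
    ExpansiveRay X d := by
  refine hD.expansiveRay ?_ ?_
  · rintro rfl
    simp [crossR] at hd
  · rintro v hv c hc rfl
    rw [crossR_smul_right, crossR_toR2] at hd
    have : (0 : ℝ) ≤ crossZ u v := by exact_mod_cast hu v hv
    nlinarith

lemma NonexpansiveDirSet.twoSidedClosing (hX : IsSubshift X) (hD : NonexpansiveDirSet X D)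
    (hcl : ∀ v ∈ D, ClosingRay X v) {u : Z2} (hu : Int.gcd u.1 u.2 = 1) :
    TwoSidedClosing X u := by
  refine ClosingRay.twoSidedClosing hX hu ?_
  by_cases h : ExpansiveRay X (toR2 u)
  · exact h.closingRay
  · obtain ⟨v, hv, hvu⟩ := hD.2.2 _ (toR2_ne_zero (ne_zero_of_gcd hu)) h
    rw [eq_of_sameRay (hD.1 v hv) hu hvu]
    exact hcl v hv

/-- Configurations which agree far out on a half-infinite strip agree on the whole strip, if the
strip is deterministic in that direction. -/
lemma eq_on_strip [Finite A] (hX : IsSubshift X) {S : Set Z2} (hSf : S.Finite) {u : Z2}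
    (hS : CodesZ X S {p | p + u ∈ S}) {x x' : Config A} (hx : x ∈ X) (hx' : x' ∈ X) (K₀ : ℤ)
    (h : ∀ k ≤ K₀, ∀ p, p - k • u ∈ S → x p = x' p) (K : ℤ) (p : Z2) (hp : p - K • u ∈ S) :
    x p = x' p := by
  have hdet : ∀ y ∈ X, ∀ y' ∈ X, ∀ k : ℤ, (∀ q, q - k • u ∈ S → y q = y' q) →
      ∀ n : ℕ, ∀ q, q - (k - n) • u ∈ S → y q = y' q := by
    intro y hy y' hy' k hk n
    induction n with
    | zero => simpa using hk
    | succ n ih =>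
      intro q hq
      have h1 : CodesZ X {q | q - (k - n) • u ∈ S} {q | q + u - (k - n) • u ∈ S} := by
        refine hS.shift hX ((k - n) • u) ?_ ?_
        · intro q hq
          rw [Set.mem_ofPred_eq, add_sub_cancel_left]
          exact hq
        · intro q hq
          rw [Set.mem_ofPred_eq] at hq ⊢
          rwa [sub_add_eq_add_sub]
      refine h1 y hy y' hy' (fun q hq => ih q hq) q ?_
      rw [Set.mem_ofPred_eq]
      convert hq using 1
      push_cast
      rw [sub_add_eq_sub_sub (k) (n : ℤ) 1, sub_smul (k - n : ℤ) 1, one_smul]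
      abel
  have := hSf.to_subtype
  obtain ⟨a, b, hab, hpat⟩ : ∃ a b : ℕ, a < b ∧ ∀ q ∈ S,
      x (q + (K + a) • u) = x (q + (K + b) • u) ∧ x' (q + (K + a) • u) = x' (q + (K + b) • u) := by
    obtain ⟨a, b, hab, he⟩ := Finite.exists_ne_map_eq_of_infinite
      (fun (n : ℕ) (q : S) => (x (q + (K + n) • u), x' (q + (K + n) • u)))
    have he' : ∀ q ∈ S, x (q + (K + a) • u) = x (q + (K + b) • u) ∧
        x' (q + (K + a) • u) = x' (q + (K + b) • u) := fun q hq =>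
      Prod.ext_iff.1 (congrFun he ⟨q, hq⟩)
    rcases lt_or_gt_of_ne hab with hlt | hlt
    · exact ⟨a, b, hlt, he'⟩
    · exact ⟨b, a, hlt, fun q hq => ⟨(he' q hq).1.symm, (he' q hq).2.symm⟩⟩
  have hper : ∀ y ∈ X, (∀ q ∈ S, y (q + (K + a) • u) = y (q + (K + b) • u)) →
      ∀ k ≤ K, ∀ q, q - k • u ∈ S → y q = y (((b : ℤ) - a) • u + q) := by
    intro y hy hyp k hk q hq
    refine hdet y hy _ (hX.2 (((b : ℤ) - a) • u) y hy) (K + a) ?_ (K + a - k).toNat q ?_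
    · intro q hq
      have := hyp _ hq
      rw [sub_add_cancel] at this
      rw [this, shiftAct]
      congr 1
      rw [sub_smul, add_smul, add_smul]
      abel
    · rw [Int.toNat_of_nonneg (by omega), sub_sub_cancel]
      exact hq
  have hagree : ∀ n : ℕ, ∀ k ≤ K, k - n * ((b : ℤ) - a) ≤ K₀ → ∀ q, q - k • u ∈ S →
      x q = x' q := by
    intro n
    induction n with
    | zero =>
      intro k _ hk q hq
      exact h k (by simpa using hk) q hq
    | succ n ih =>
      intro k hkK hk q hq
      push_cast at hk
      have hk' : k - ((b : ℤ) - a) ≤ K := by omega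
      have hq' : (q - ((b : ℤ) - a) • u) - (k - ((b : ℤ) - a)) • u ∈ S := by
        convert hq using 1
        rw [sub_smul k]
        abel
      have h1 := hper x hx (fun q hq => (hpat q hq).1) _ hk' _ hq'
      have h2 := hper x' hx' (fun q hq => (hpat q hq).2) _ hk' _ hq'
      rw [add_sub_cancel] at h1 h2
      rw [← h1, ← h2]
      exact ih _ hk' (by linarith) _ hq'
  refine hagree (K - K₀).toNat K le_rfl ?_ p hp
  have h1 := Int.self_le_toNat (K - K₀)
  have h2 : (1 : ℤ) ≤ b - a := by omega
  have h3 : (0 : ℤ) ≤ (K - K₀).toNat := by positivity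
  nlinarith

/-- The nonexpansive directions do not lie in a half plane, unless they lie on its boundary. -/
lemma NonexpansiveDirSet.crossZ_eq_zero [Finite A] (hX : IsSubshift X)
    (hD : NonexpansiveDirSet X D) (hcl : ∀ v ∈ D, ClosingRay X v) {u : Z2}
    (hu : Int.gcd u.1 u.2 = 1) (h : ∀ v ∈ D, 0 ≤ crossZ u v) : ∀ v ∈ D, crossZ u v = 0 := by
  intro v hv
  by_contra hne
  have hpos : 0 < crossZ u v := lt_of_le_of_ne (h v hv) (Ne.symm hne)
  obtain ⟨t, ht⟩ := exists_crossZ_eq_one hu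
  have hgt : Int.gcd t.1 t.2 = 1 := by
    refine gcd_eq_one_of_crossZ_eq_one (t := -u) ?_
    rw [crossZ_neg_right, ← crossZ_comm, ht]
  have cl : ∀ {w : Z2}, Int.gcd w.1 w.2 = 1 → TwoSidedClosing X w := hD.twoSidedClosing hX hcl
  have hcross : crossR (toR2 u) (toR2 t) = 1 := by
    rw [crossR_toR2, ht, Int.cast_one]
  have hcross0 : crossR (toR2 u) (toR2 u) = 0 := by
    rw [crossR_toR2, crossZ_self, Int.cast_zero]
  have hneg : ∀ w : Z2, crossR (toR2 u) (toR2 (-w)) = -crossR (toR2 u) (toR2 w) := by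
    intro w
    rw [crossR_toR2, crossR_toR2, crossZ_neg_right, Int.cast_neg]
  obtain ⟨F, hF, hFne, hFc⟩ := exists_parallelogram_window hX ht {0, 3} (by
    rintro i (rfl | rfl)
    · change ∃ r C, LocalCornerCoding X (-t) u r C
      refine exists_localCornerCoding hX ?_ (cl (gcd_neg hgt)) (cl hu) ?_
      · rw [crossZ_neg_left, ← crossZ_comm, ht]
        exact one_pos
      · intro s s' hs hs'
        refine hD.expansiveRay_of_crossR_neg h ?_
        rw [crossR_add_right, crossR_smul_right, crossR_smul_right, hneg, hcross, hcross0]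
        linarith
    · change ∃ r C, LocalCornerCoding X (-u) (-t) r C
      refine exists_localCornerCoding hX ?_ (cl (gcd_neg hu)) (cl (gcd_neg hgt)) ?_
      · rw [crossZ_neg_left, crossZ_neg_right, neg_neg, ht]
        exact one_pos
      · intro s s' hs hs'
        refine hD.expansiveRay_of_crossR_neg h ?_
        rw [crossR_add_right, crossR_smul_right, crossR_smul_right, hneg, hneg, hcross, hcross0]
        linarith)
  obtain ⟨r₀, hr₀, hslab⟩ := exists_slab_codes hX ht hF hFne
    (hD.expansiveRay_of_crossR_neg h (by rw [hneg, hcross]; norm_num))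
    ((hFc 0 (by simp)).mono (by
      rintro p ⟨j, hj, hp⟩
      fin_cases j
      · exact absurd rfl hj
      · exact Or.inl hp
      · exact Or.inr (Or.inl hp)
      · exact Or.inr (Or.inr hp)) (by
      intro p hp
      simpa using hp))
    ((hFc 3 (by simp)).mono (by
      rintro p ⟨j, hj, hp⟩
      fin_cases j
      · left
        simpa using hp
      · exact Or.inr (Or.inl hp)
      · exact Or.inr (Or.inr hp)
      · exact absurd rfl hj) (by
      intro p hp
      exact hp))
  refine hD.2.1 v hv ?_
  intro x hx x' hx' hagree p _
  obtain ⟨f, hf⟩ := hFne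
  have hS := hslab (max r₀ |crossZ u (p - f)|) (le_max_left _ _)
  have hSf := slab_finite u t hF (max r₀ |crossZ u (p - f)|)
  obtain ⟨b, hb0, hb⟩ := exists_crossZ_bound hSf v v
  refine eq_on_strip hX hSf hS hx hx' (-b) ?_ (crossZ (p - f) t) p ?_
  · intro k hk q hq
    refine hagree q ?_
    have h1 := (abs_le.1 (hb _ hq).1).1
    rw [crossZ_sub_right, crossZ_smul_right, crossZ_comm v u] at h1
    have h2 : (0 : ℤ) ≤ crossZ v q := by nlinarith
    change 0 ≤ crossR (toR2 v) (toR2 q)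
    rw [crossR_toR2]
    exact_mod_cast h2
  · refine ⟨0, crossZ u (p - f), le_rfl, hr₀.trans (le_max_left _ _), le_max_right _ _, ?_⟩
    have := eq_smul_add_smul ht (p - f)
    convert hf using 1
    rw [zero_smul, zero_add, sub_sub, ← this, sub_sub_cancel]

end Balance

section Weights

lemma sum_single_smul {D : Finset Z2} {v : Z2} (hv : v ∈ D) (a : ℤ) :
    ∑ w ∈ D, (Pi.single v a : Z2 → ℤ) w • w = a • v := by
  rw [Finset.sum_eq_single_of_mem v hv, Pi.single_eq_same]
  intro w _ hw
  rw [Pi.single_eq_of_ne hw, zero_smul]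

lemma crossZ_cyclic (a b c : Z2) : crossZ b c • a + crossZ c a • b + crossZ a b • c = 0 := by
  ext
  · simp only [Prod.fst_add, Prod.smul_fst, smul_eq_mul, crossZ, Prod.fst_zero]
    ring
  · simp only [Prod.snd_add, Prod.smul_snd, smul_eq_mul, crossZ, Prod.snd_zero]
    ring

variable {D : Finset Z2}

lemma exists_weight (hprim : ∀ v ∈ D, Int.gcd v.1 v.2 = 1)
    (hbal : ∀ u : Z2, Int.gcd u.1 u.2 = 1 → (∀ v ∈ D, 0 ≤ crossZ u v) → ∀ v ∈ D, crossZ u v = 0)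
    {v : Z2} (hv : v ∈ D) :
    ∃ c : Z2 → ℤ, (∀ w, 0 ≤ c w) ∧ 0 < c v ∧ ∑ w ∈ D, c w • w = 0 := by
  have hvp := hprim v hv
  obtain ⟨t, ht⟩ := exists_crossZ_eq_one hvp
  have hsingle : ∀ (w : Z2) {a : ℤ}, 0 ≤ a → ∀ w', 0 ≤ (Pi.single w a : Z2 → ℤ) w' := by
    intro w a ha w'
    rw [Pi.single_apply]
    split_ifs
    · exact ha
    · exact le_rfl
  by_cases hleft : ∃ w ∈ D, 0 < crossZ v w
  · have hne : (D.filter fun w => 0 < crossZ v w).Nonempty := by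
      obtain ⟨w, hw, hw'⟩ := hleft
      exact ⟨w, Finset.mem_filter.2 ⟨hw, hw'⟩⟩
    obtain ⟨w₁, hw₁, hmin⟩ := Finset.exists_min_image _
      (fun w => (crossZ w t : ℚ) / crossZ v w) hne
    rw [Finset.mem_filter] at hw₁
    have hlast : ∀ d ∈ D, 0 < crossZ v d → crossZ w₁ d ≤ 0 := by
      intro d hd hpos
      have h1 := hmin d (Finset.mem_filter.2 ⟨hd, hpos⟩)
      rw [div_le_div_iff₀ (by exact_mod_cast hw₁.2) (by exact_mod_cast hpos)] at h1
      have h2 : crossZ w₁ t * crossZ v d ≤ crossZ d t * crossZ v w₁ := by exact_mod_cast h1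
      have h3 : crossZ v t * crossZ w₁ d =
          crossZ w₁ t * crossZ v d - crossZ d t * crossZ v w₁ := by
        simp only [crossZ]
        ring
      rw [ht, one_mul] at h3
      linarith
    obtain ⟨w₂, hw₂, hpos⟩ : ∃ w₂ ∈ D, 0 < crossZ w₁ w₂ := by
      by_contra hcon
      push Not at hcon
      have := hbal (-w₁) (gcd_neg (hprim _ hw₁.1))
        (fun d hd => by rw [crossZ_neg_left]; linarith [hcon d hd]) v hv
      rw [crossZ_neg_left, ← crossZ_comm] at this
      linarith [hw₁.2]
    have hle : crossZ v w₂ ≤ 0 := by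
      by_contra hcon
      linarith [hlast w₂ hw₂ (not_le.1 hcon)]
    have hle' : 0 ≤ crossZ w₂ v := by
      rw [crossZ_comm]
      linarith
    refine ⟨Pi.single v (crossZ w₁ w₂) + Pi.single w₁ (crossZ w₂ v) + Pi.single w₂ (crossZ v w₁),
      fun w => ?_, ?_, ?_⟩
    · exact add_nonneg (add_nonneg (hsingle _ hpos.le w) (hsingle _ hle' w)) (hsingle _ hw₁.2.le w)
    · have h1 := hsingle w₁ hle' v
      have h2 := hsingle w₂ hw₁.2.le v
      simp only [Pi.add_apply, Pi.single_eq_same]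
      linarith
    · simp only [Pi.add_apply, add_smul, Finset.sum_add_distrib]
      rw [sum_single_smul hv, sum_single_smul hw₁.1, sum_single_smul hw₂, crossZ_cyclic]
  · push Not at hleft
    have hzero : ∀ w ∈ D, crossZ v w = 0 := by
      intro w hw
      have := hbal (-v) (gcd_neg hvp)
        (fun d hd => by rw [crossZ_neg_left]; linarith [hleft d hd]) w hw
      rwa [crossZ_neg_left, neg_eq_zero] at this
    by_cases hneg : -v ∈ D
    · refine ⟨Pi.single v 1 + Pi.single (-v) 1, fun w => ?_, ?_, ?_⟩
      · exact add_nonneg (hsingle _ zero_le_one w) (hsingle _ zero_le_one w)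
      · have h1 := hsingle (-v) zero_le_one v
        simp only [Pi.add_apply, Pi.single_eq_same]
        linarith
      · simp only [Pi.add_apply, add_smul, Finset.sum_add_distrib]
        rw [sum_single_smul hv, sum_single_smul hneg]
        simp
    · exfalso
      have heq : ∀ w ∈ D, w = v := fun w hw =>
        (eq_or_eq_neg_of_crossZ_eq_zero hvp (hprim w hw) (hzero w hw)).resolve_right
          (fun h => hneg (h ▸ hw))
      have hcr : crossZ (-t) v = 1 := by
        rw [crossZ_neg_left, ← crossZ_comm, ht]
      have := hbal (-t) (gcd_eq_one_of_crossZ_eq_one hcr)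
        (fun d hd => by rw [heq d hd, hcr]; exact zero_le_one) v hv
      linarith

/-- Balanced directions admit positive integer weights with vanishing weighted sum. -/
lemma exists_positive_weights (hprim : ∀ v ∈ D, Int.gcd v.1 v.2 = 1)
    (hbal : ∀ u : Z2, Int.gcd u.1 u.2 = 1 →
      (∀ v ∈ D, 0 ≤ crossZ u v) → ∀ v ∈ D, crossZ u v = 0) :
    ∃ m : Z2 → ℤ, (∀ v ∈ D, 0 < m v) ∧ ∑ v ∈ D, m v • v = 0 := by
  choose! c hc0 hcpos hcsum using fun v (hv : v ∈ D) => exists_weight hprim hbal hv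
  refine ⟨fun w => ∑ v ∈ D, c v w, fun v hv => ?_, ?_⟩
  · exact Finset.sum_pos' (fun w hw => hc0 w hw v) ⟨v, hv, hcpos v hv⟩
  · simp only [Finset.sum_smul]
    rw [Finset.sum_comm]
    exact Finset.sum_eq_zero hcsum

end Weights

section Construction

/-- The angle of a lattice vector. -/
noncomputable def angle (v : Z2) : ℝ := Complex.arg ⟨v.1, v.2⟩

lemma exists_radius {v : Z2} (hv : v ≠ 0) :
    ∃ ρ : ℝ, 0 < ρ ∧ (v.1 : ℝ) = ρ * Real.cos (angle v) ∧ (v.2 : ℝ) = ρ * Real.sin (angle v) := by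
  refine ⟨‖(⟨v.1, v.2⟩ : ℂ)‖, ?_, ?_, ?_⟩
  · rw [norm_pos_iff]
    intro h
    have h1 : (v.1 : ℝ) = 0 := congrArg Complex.re h
    have h2 : (v.2 : ℝ) = 0 := congrArg Complex.im h
    exact hv (Prod.ext (by exact_mod_cast h1) (by exact_mod_cast h2))
  · exact (Complex.norm_mul_cos_arg ⟨v.1, v.2⟩).symm
  · exact (Complex.norm_mul_sin_arg ⟨v.1, v.2⟩).symm

lemma exists_crossZ_eq_mul_sin {v w : Z2} (hv : v ≠ 0) (hw : w ≠ 0) :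
    ∃ ρ : ℝ, 0 < ρ ∧ (crossZ v w : ℝ) = ρ * Real.sin (angle w - angle v) := by
  obtain ⟨a, ha, ha1, ha2⟩ := exists_radius hv
  obtain ⟨b, hb, hb1, hb2⟩ := exists_radius hw
  refine ⟨a * b, mul_pos ha hb, ?_⟩
  rw [crossZ, Real.sin_sub]
  push_cast
  rw [ha1, ha2, hb1, hb2]
  ring

lemma angle_injOn {D : Finset Z2} (hprim : ∀ v ∈ D, Int.gcd v.1 v.2 = 1) :
    Set.InjOn angle D := by
  intro v hv w hw h
  have hv0 := ne_zero_of_gcd (hprim v hv)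
  have hw0 := ne_zero_of_gcd (hprim w hw)
  obtain ⟨ρ, -, hρ⟩ := exists_crossZ_eq_mul_sin hv0 hw0
  rw [h, sub_self, Real.sin_zero, mul_zero, Int.cast_eq_zero] at hρ
  refine ((eq_or_eq_neg_of_crossZ_eq_zero (hprim v hv) (hprim w hw) hρ).resolve_right ?_).symm
  rintro rfl
  obtain ⟨a, ha, ha1, ha2⟩ := exists_radius hv0
  obtain ⟨b, hb, hb1, hb2⟩ := exists_radius hw0
  rw [← h] at hb1 hb2
  push_cast [Prod.fst_neg, Prod.snd_neg] at hb1 hb2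
  have h1 : (a + b) * Real.cos (angle v) = 0 := by linarith
  have h2 : (a + b) * Real.sin (angle v) = 0 := by linarith
  have hab : a + b ≠ 0 := by positivity
  have h3 := Real.sin_sq_add_cos_sq (angle v)
  rw [(mul_eq_zero.1 h1).resolve_left hab, (mul_eq_zero.1 h2).resolve_left hab] at h3
  norm_num at h3

/-- The counterclockwise cyclic enumeration of a set of directions. -/
lemma exists_cyclic_order {D : Finset Z2} (hprim : ∀ v ∈ D, Int.gcd v.1 v.2 = 1)
    (hne : 0 < D.card) :
    ∃ V : ℕ → Z2, Function.Periodic V D.card ∧ Set.BijOn V (Finset.range D.card) D ∧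
      ∀ i k l, 0 < k → k < l → l < D.card → crossZ (V i) (V (i + k)) ≤ 0 →
        crossZ (V i) (V (i + l)) < 0 := by
  have hcard : (D.image angle).card = D.card := Finset.card_image_of_injOn (angle_injOn hprim)
  set e := (D.image angle).orderEmbOfFin hcard with he
  have hmem : ∀ k, ∃ v ∈ D, angle v = e k := fun k =>
    Finset.mem_image.1 (Finset.orderEmbOfFin_mem _ hcard k)
  choose v hvD hv using hmem
  let V : ℕ → Z2 := fun k => v ⟨k % D.card, Nat.mod_lt _ hne⟩
  let Θ : ℕ → ℝ := fun k =>
    e ⟨k % D.card, Nat.mod_lt _ hne⟩ + 2 * Real.pi * ((k / D.card : ℕ) : ℝ)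
  have hVD : ∀ k, V k ∈ D := fun k => hvD _
  have hV0 : ∀ k, V k ≠ 0 := fun k => ne_zero_of_gcd (hprim _ (hVD k))
  have hangle : ∀ k, -Real.pi < e k ∧ e k ≤ Real.pi := fun k => by
    rw [← hv]
    exact ⟨Complex.neg_pi_lt_arg _, Complex.arg_le_pi _⟩
  have hmono : StrictMono Θ := by
    intro a b hab
    have hdiv : a / D.card ≤ b / D.card := Nat.div_le_div_right hab.le
    simp only [Θ]
    rcases hdiv.eq_or_lt with h1 | h1
    · rw [h1]
      have : a % D.card < b % D.card := by
        have h2 := Nat.div_add_mod a D.card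
        have h3 := Nat.div_add_mod b D.card
        rw [h1] at h2
        omega
      have h4 : e ⟨a % D.card, Nat.mod_lt _ hne⟩ < e ⟨b % D.card, Nat.mod_lt _ hne⟩ :=
        e.strictMono this
      linarith
    · have h2 : ((a / D.card : ℕ) : ℝ) + 1 ≤ ((b / D.card : ℕ) : ℝ) := by exact_mod_cast h1
      have h3 := (hangle ⟨a % D.card, Nat.mod_lt _ hne⟩).2
      have h4 := (hangle ⟨b % D.card, Nat.mod_lt _ hne⟩).1
      nlinarith [Real.pi_pos]
  have hturn : ∀ i, Θ (i + D.card) = Θ i + 2 * Real.pi := by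
    intro i
    simp only [Θ, Nat.add_mod_right, Nat.add_div_right i hne]
    push_cast
    ring
  have hcross : ∀ i j, ∃ ρ : ℝ, 0 < ρ ∧
      (crossZ (V i) (V j) : ℝ) = ρ * Real.sin (Θ j - Θ i) := by
    intro i j
    obtain ⟨ρ, h1, h2⟩ := exists_crossZ_eq_mul_sin (hV0 i) (hV0 j)
    refine ⟨ρ, h1, ?_⟩
    rw [h2]
    simp only [V, Θ, hv]
    congr 1
    rw [← Real.sin_add_int_mul_two_pi _ (((j / D.card : ℕ) : ℤ) - ((i / D.card : ℕ) : ℤ))]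
    congr 1
    rw [Int.cast_sub, Int.cast_natCast, Int.cast_natCast]
    ring
  refine ⟨V, fun k => by simp only [V, Nat.add_mod_right], ⟨fun k _ => hVD k, ?_, ?_⟩, ?_⟩
  · intro a ha b hb hab
    have ha' : a < D.card := by simpa using ha
    have hb' : b < D.card := by simpa using hb
    have h1 := congrArg angle hab
    simp only [V, hv] at h1
    have h2 := congrArg Fin.val (e.injective h1)
    simpa [Nat.mod_eq_of_lt ha', Nat.mod_eq_of_lt hb'] using h2
  · intro w hw
    have h1 : angle w ∈ Set.range e := by
      rw [he, Finset.range_orderEmbOfFin]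
      exact Finset.mem_coe.2 (Finset.mem_image_of_mem _ hw)
    obtain ⟨k, hk⟩ := h1
    refine ⟨k, by simp, ?_⟩
    have h2 : V k = v k := by
      simp only [V, Nat.mod_eq_of_lt k.2]
    rw [h2]
    exact angle_injOn hprim (hvD k) hw (by rw [hv, hk])
  · intro i k l hk hkl hl hneg
    obtain ⟨ρ, h1, h2⟩ := hcross i (i + k)
    obtain ⟨ρ', h1', h2'⟩ := hcross i (i + l)
    have h3 : Θ i < Θ (i + k) := hmono (by omega)
    have h4 : Θ (i + k) < Θ (i + l) := hmono (by omega)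
    have h5 : Θ (i + l) < Θ (i + D.card) := hmono (by omega)
    rw [hturn] at h5
    have h6 : Real.pi ≤ Θ (i + k) - Θ i := by
      by_contra hlt
      have := Real.sin_pos_of_pos_of_lt_pi (sub_pos.2 h3) (not_le.1 hlt)
      have h7 : (0 : ℝ) < crossZ (V i) (V (i + k)) := by
        rw [h2]
        exact mul_pos h1 this
      have h8 : 0 < crossZ (V i) (V (i + k)) := by exact_mod_cast h7
      linarith
    have h7 : Real.sin (Θ (i + l) - Θ i) < 0 := by
      have := Real.sin_pos_of_pos_of_lt_pi (x := Θ (i + l) - Θ i - Real.pi) (by linarith)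
        (by linarith)
      rw [Real.sin_sub_pi] at this
      linarith
    have h8 : (crossZ (V i) (V (i + l)) : ℝ) < 0 := by
      rw [h2']
      exact mul_neg_of_pos_of_neg h1' h7
    exact_mod_cast h8

/-- Partial sums are positive if the total vanishes and the signs of the terms change once. -/
lemma sum_range_pos_of_sign {g : ℕ → ℤ} {N : ℕ} (h0 : ∑ k ∈ Finset.range N, g k = 0)
    (hs : ∀ k l, k < l → l < N → g k ≤ 0 → g l < 0) {j : ℕ} (hj0 : 0 < j) (hj : j < N) :
    0 < ∑ k ∈ Finset.range j, g k := by
  by_contra hcon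
  obtain ⟨k, hk, hgk⟩ : ∃ k ∈ Finset.range j, g k ≤ 0 := by
    by_contra hall
    push Not at hall
    exact hcon (Finset.sum_pos hall ⟨0, Finset.mem_range.2 hj0⟩)
  have h1 := Finset.sum_range_add_sum_Ico g hj.le
  have h2 : ∑ k ∈ Finset.Ico j N, g k < 0 := by
    refine Finset.sum_neg (fun l hl => ?_) ⟨j, Finset.mem_Ico.2 ⟨le_rfl, hj⟩⟩
    rw [Finset.mem_Ico] at hl
    exact hs k l ((Finset.mem_range.1 hk).trans_le hl.1) hl.2 hgk
  linarith

/-- A set of at least three balanced directions is the set of edge directions of a polygon. -/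
lemma exists_polygon {D : Finset Z2} (hprim : ∀ v ∈ D, Int.gcd v.1 v.2 = 1)
    {N : ℕ} (hN : D.card = N + 3) {c : Z2 → ℤ} (hc : ∀ v ∈ D, 0 < c v)
    (hsum : ∑ v ∈ D, c v • v = 0) :
    ∃ (P : IntPolygon) (v : Fin (P.n + 3) → Z2) (m : Fin (P.n + 3) → ℤ),
      HasEdges P v m ∧ Set.range v = D := by
  obtain ⟨V, hper, hbij, hsign⟩ := exists_cyclic_order hprim (by omega)
  rw [hN] at hper hbij hsign
  let W : ℕ → Z2 := fun k => ∑ l ∈ Finset.range k, c (V l) • V l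
  have hWsucc : ∀ k, W (k + 1) = W k + c (V k) • V k := fun k => Finset.sum_range_succ _ _
  have hVD : ∀ k, V k ∈ D := by
    intro k
    rw [← hper.map_mod_nat k]
    exact hbij.mapsTo (by simpa using Nat.mod_lt _ (by omega))
  have hWper : Function.Periodic W (N + 3) := by
    intro k
    induction k with
    | zero =>
      have h1 : ∑ v ∈ D, c v • v = W (N + 3) := by
        refine (Finset.sum_nbij V (fun k _ => hVD k) hbij.injOn hbij.surjOn fun k _ => rfl).symm
      rw [zero_add, ← h1, hsum]
      simp [W]
    | succ k ih => rw [add_right_comm, hWsucc, ih, hper, ← hWsucc]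
  have hpos : ∀ i k, 0 < k → k < N + 2 → 0 < crossZ (V i) (W (i + 1 + k) - W (i + 1)) := by
    intro i k hk hk'
    have hpart : ∀ j, ∑ l ∈ Finset.range j, c (V (i + 1 + l)) * crossZ (V i) (V (i + 1 + l)) =
        crossZ (V i) (W (i + 1 + j) - W (i + 1)) := by
      intro j
      induction j with
      | zero => simp [crossZ_zero_right]
      | succ j ih =>
        rw [Finset.sum_range_succ, ih, ← add_assoc, hWsucc (i + 1 + j), add_sub_right_comm, crossZ_add_right,
          crossZ_smul_right]
    rw [← hpart]
    refine sum_range_pos_of_sign ?_ ?_ hk hk'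
    · rw [hpart, show i + 1 + (N + 2) = i + (N + 3) by ring, hWper, hWsucc, sub_add_cancel_left,
        crossZ_neg_right, crossZ_smul_right, crossZ_self, mul_zero, neg_zero]
    · intro a b hab hb h
      have h1 := nonpos_of_mul_nonpos_right h (hc _ (hVD _))
      rw [add_assoc] at h1
      have := hsign i (1 + a) (1 + b) (by omega) (by omega) (by omega) h1
      rw [← add_assoc] at this
      exact mul_neg_of_pos_of_neg (hc _ (hVD _)) this
  have hsuccval : ∀ i : Fin (N + 3), W (i + 1 : Fin (N + 3)).val = W (i.val + 1) := by
    intro i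
    rw [Fin.val_add, hWper.map_mod_nat]
    simp
  have hedge : ∀ i : Fin (N + 3), W (i + 1 : Fin (N + 3)).val - W i.val = c (V i) • V i := by
    intro i
    rw [hsuccval, hWsucc, add_sub_cancel_left]
  let P : IntPolygon :=
    { n := N
      vert := fun i => W i.val
      convex := by
        intro i j hji hji1
        rw [hedge, crossZ_smul_left]
        refine mul_pos (hc _ (hVD _)) ?_
        have hi := i.2
        have hj := j.2
        have h1 : j.val ≠ i.val := fun h => hji (Fin.ext h)
        have h2 : j.val ≠ (i.val + 1) % (N + 3) := fun h => hji1 (Fin.ext (by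
          rw [h, Fin.val_add]
          simp))
        have hshift : crossZ (V i) (W j.val - W i.val) = crossZ (V i) (W j.val - W (i.val + 1)) := by
          rw [hWsucc, ← sub_sub, crossZ_sub_right (V i) (W j.val - W i.val), crossZ_smul_right,
            crossZ_self, mul_zero, sub_zero]
        rw [hshift]
        rcases lt_or_gt_of_ne h1 with h3 | h3
        · have h4 : 0 < j.val + (N + 3) - (i.val + 1) := by
            rcases Nat.lt_or_ge (i.val + 1) (N + 3) with h5 | h5
            · omega
            · rw [show i.val + 1 = N + 3 by omega, Nat.mod_self] at h2
              omega
          have := hpos i _ h4 (by omega)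
          rwa [Nat.add_sub_of_le (by omega), hWper] at this
        · rw [Nat.mod_eq_of_lt (by omega)] at h2
          have := hpos i (j.val - (i.val + 1)) (by omega) (by omega)
          rwa [Nat.add_sub_of_le (by omega)] at this }
  refine ⟨P, fun i => V i.val, fun i => c (V i.val), fun i => ⟨hc _ (hVD _), hedge i⟩, ?_⟩
  ext w
  constructor
  · rintro ⟨i, rfl⟩
    exact hVD _
  · intro hw
    obtain ⟨k, hk, rfl⟩ := hbij.surjOn hw
    exact ⟨⟨k, by simpa using hk⟩, rfl⟩

end Construction

section Recoding

lemma toR2_injective : Function.Injective toR2 := by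
  intro p q h
  have h1 : (p.1 : ℝ) = q.1 := congrArg Prod.fst h
  have h2 : (p.2 : ℝ) = q.2 := congrArg Prod.snd h
  exact Prod.ext (by exact_mod_cast h1) (by exact_mod_cast h2)

lemma HasEdges.toR2_mem_carrier {P : IntPolygon} {v : Fin (P.n + 3) → Z2}
    {m : Fin (P.n + 3) → ℤ} (h : HasEdges P v m) {i : Fin (P.n + 3)} {w : Z2}
    (hw : w ∈ vertexNeighbours P v i) : toR2 w ∈ P.carrier := by
  have hvert : ∀ j, toR2 (P.vert j) ∈ P.carrier := fun j =>
    subset_convexHull ℝ _ ⟨j, rfl⟩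
  have hstep : ∀ (a b c : Z2) (k : ℤ), 0 < k → toR2 a ∈ P.carrier → toR2 b ∈ P.carrier →
      b - a = k • c → toR2 (a + c) ∈ P.carrier := by
    intro a b c k hk ha hb habc
    have hkR : (1 : ℝ) ≤ k := by exact_mod_cast hk
    have := (convex_convexHull ℝ _).add_smul_sub_mem ha hb (t := (k : ℝ)⁻¹)
      ⟨by positivity, inv_le_one_of_one_le₀ hkR⟩
    rwa [← toR2_sub, habc, toR2_smul, smul_smul, inv_mul_cancel₀ (by positivity), one_smul,
      ← toR2_add] at this
  rcases hw.2 with ⟨j, rfl⟩ | rfl | rfl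
  · exact hvert j
  · rw [sub_eq_add_neg]
    refine hstep _ _ _ _ (h (i - 1)).1 (hvert i) (hvert (i - 1)) ?_
    have := (h (i - 1)).2
    rw [IntPolygon.edgeVec, sub_add_cancel] at this
    rw [smul_neg, ← this, neg_sub]
  · exact hstep _ _ _ _ (h i).1 (hvert i) (hvert (i + 1)) (h i).2

lemma crossR_smul_add_smul (u a b : Z2) (s t : ℝ) :
    crossR (toR2 u) (s • toR2 a + t • toR2 b) = s * crossZ u a + t * crossZ u b := by
  rw [crossR_add_right, crossR_smul_right, crossR_smul_right, crossR_toR2, crossR_toR2]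

/-- The directions strictly between two consecutive edges are not directions of edges. -/
lemma HasEdges.smul_add_smul_ne {P : IntPolygon} {v : Fin (P.n + 3) → Z2}
    {m : Fin (P.n + 3) → ℤ} (h : HasEdges P v m) (i j : Fin (P.n + 3)) {s t c : ℝ}
    (hs : 0 < s) (ht : 0 < t) (hc : 0 < c) :
    s • toR2 (v (i - 1)) + t • toR2 (v i) ≠ c • toR2 (v j) := by
  intro heq
  have hδ := h.one_le_crossZ_pred i
  have hδR : (1 : ℝ) ≤ crossZ (v (i - 1)) (v i) := by exact_mod_cast hδ
  have h1 : 0 < crossZ (v (i - 1)) (v j) := by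
    have e := crossR_smul_add_smul (v (i - 1)) (v (i - 1)) (v i) s t
    rw [heq, crossR_smul_right, crossR_toR2, crossZ_self, Int.cast_zero, mul_zero, zero_add] at e
    have : (0 : ℝ) < crossZ (v (i - 1)) (v j) := by
      refine pos_of_mul_pos_right ?_ hc.le
      rw [e]
      positivity
    exact_mod_cast this
  have h2 : 0 < crossZ (v j) (v i) := by
    have e := crossR_smul_add_smul (v i) (v (i - 1)) (v i) s t
    rw [heq, crossR_smul_right, crossR_toR2, crossZ_self, Int.cast_zero, mul_zero, add_zero,
      crossZ_comm (v i), crossZ_comm (v i)] at e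
    push_cast at e
    have : (0 : ℝ) < crossZ (v j) (v i) := by
      refine pos_of_mul_pos_right (a := c) ?_ hc.le
      have : 0 < s * (crossZ (v (i - 1)) (v i) : ℝ) := by positivity
      linarith
    exact_mod_cast this
  have hrel := edgeFun_relation (v := v) 1 (i - 1) j i (P.vert i)
  rw [h.edgeFun_pred, edgeFun_self] at hrel
  have h3 := h.edgeFun_nonneg j i
  have h4 := h.edgeFun_nonneg (i - 1) j
  have h5 := h.edgeFun_nonneg i j
  by_cases hj1 : j = i - 1
  · rw [hj1, crossZ_self] at h1
    exact lt_irrefl _ h1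
  by_cases hj2 : j = i
  · rw [hj2, crossZ_self] at h2
    exact lt_irrefl _ h2
  have h6 := h.one_le_edgeFun hj1 (by rwa [sub_add_cancel])
  nlinarith

lemma exists_recoding_polygon {A : Type} [Fintype A] {X : Set (Config A)} (hX : IsSubshift X)
    {D : Finset Z2} (hD : NonexpansiveDirSet X D) (hcl : ∀ v ∈ D, ClosingRay X v)
    {P : IntPolygon} {v : Fin (P.n + 3) → Z2} {m : Fin (P.n + 3) → ℤ} (h : HasEdges P v m)
    (hv : Set.range v = D) :
    ∃ (A' : Type) (_ : Fintype A') (Y : Set (Config A')),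
      IsSubshift Y ∧ IsRecoding X Y ∧ IsCodingPolygon Y P := by
  have hvD : ∀ i, v i ∈ D := fun i => Finset.mem_coe.1 (hv ▸ Set.mem_range_self i)
  have hclosing : ∀ i, TwoSidedClosing X (v i) := fun i =>
    (hcl _ (hvD i)).twoSidedClosing hX (hD.1 _ (hvD i))
  obtain ⟨F, hF, hne, hc⟩ := h.exists_window hX Set.univ fun i _ =>
    exists_localCornerCoding hX (h.one_le_crossZ_pred i) (hclosing _) (hclosing _) (by
      intro s t hs ht
      refine hD.expansiveRay ?_ ?_
      · intro h0
        have e := crossR_smul_add_smul (v (i - 1)) (v (i - 1)) (v i) s t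
        have hδ : (1 : ℝ) ≤ crossZ (v (i - 1)) (v i) := by
          exact_mod_cast h.one_le_crossZ_pred i
        rw [h0, crossZ_self] at e
        simp only [crossR, Prod.fst_zero, Prod.snd_zero, mul_zero, sub_zero, Int.cast_zero,
          zero_add] at e
        have : 0 < t * (crossZ (v (i - 1)) (v i) : ℝ) := by positivity
        linarith
      · intro w hw c hc
        obtain ⟨j, rfl⟩ : w ∈ Set.range v := by rwa [hv]
        exact h.smul_add_smul_ne i j hs ht hc)
  obtain ⟨A', hA', Y, hY, hXY, hcode⟩ := exists_recoding hX hF hne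
  refine ⟨A', hA', Y, hY, hXY, fun i y hy y' hy' hagree p hp => ?_⟩
  have := hcode (vertexNeighbours P v i) {P.vert i} ((hc i trivial).mono subset_rfl (by
    rintro p ⟨s, rfl, hs⟩
    exact hs))
  refine this y hy y' hy' (fun q hq => hagree q ⟨h.toR2_mem_carrier hq, ?_⟩) p
    (toR2_injective hp)
  exact fun hq' => hq.1 (toR2_injective hq')

lemma slab_neg_neg (u t : Z2) (F : Set Z2) (r : ℤ) (p : Z2) :
    p ∈ slab (-u) (-t) F r ↔ r • u + p ∈ slab u t F r := by
  constructor
  · rintro ⟨i, j, h1, h2, h3, h4⟩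
    refine ⟨r - i, -j, by linarith, by linarith, by rwa [abs_neg], ?_⟩
    convert h4 using 1
    rw [sub_smul, neg_smul, smul_neg, smul_neg]
    abel
  · rintro ⟨i, j, h1, h2, h3, h4⟩
    refine ⟨r - i, -j, by linarith, by linarith, by rwa [abs_neg], ?_⟩
    convert h4 using 1
    rw [smul_neg, smul_neg, sub_smul, neg_smul]
    abel

/-- With exactly two opposite nonexpansive directions, some window is coded by each of its two
neighbouring translates in these directions. -/
lemma exists_segment_window {A : Type*} [Finite A] {X : Set (Config A)} (hX : IsSubshift X)
    {D : Finset Z2} (hD : NonexpansiveDirSet X D) (hcl : ∀ v ∈ D, ClosingRay X v) {v : Z2}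
    (hv : Int.gcd v.1 v.2 = 1) (hDv : ∀ w ∈ D, crossZ v w = 0) :
    ∃ G : Set Z2, G.Finite ∧ G.Nonempty ∧ CodesZ X G {p | p + v ∈ G} ∧
      CodesZ X G {p | p - v ∈ G} := by
  obtain ⟨t, ht⟩ := exists_crossZ_eq_one hv
  have hgt : Int.gcd t.1 t.2 = 1 := by
    refine gcd_eq_one_of_crossZ_eq_one (t := -v) ?_
    rw [crossZ_neg_right, ← crossZ_comm, ht]
  have cl : ∀ {w : Z2}, Int.gcd w.1 w.2 = 1 → TwoSidedClosing X w := hD.twoSidedClosing hX hcl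
  have hexp : ∀ d, crossR (toR2 v) d ≠ 0 → ExpansiveRay X d := by
    intro d hd
    refine hD.expansiveRay ?_ ?_
    · rintro rfl
      simp [crossR] at hd
    · rintro w hw c - rfl
      rw [crossR_smul_right, crossR_toR2, hDv w hw, Int.cast_zero, mul_zero] at hd
      exact hd rfl
  have hcorner : ∀ a b : Z2, Int.gcd a.1 a.2 = 1 → Int.gcd b.1 b.2 = 1 → crossZ a b = 1 →
      (crossZ v a = 0 ∧ crossZ v b ≠ 0 ∨ crossZ v a ≠ 0 ∧ crossZ v b = 0) →
      ∃ r C, LocalCornerCoding X a b r C := by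
    intro a b ha hb hab h
    refine exists_localCornerCoding hX (by rw [hab]; exact one_pos) (cl ha) (cl hb) ?_
    intro s s' hs hs'
    refine hexp _ ?_
    rw [crossR_smul_add_smul]
    rcases h with ⟨h1, h2⟩ | ⟨h1, h2⟩
    · rw [h1, Int.cast_zero, mul_zero, zero_add]
      exact mul_ne_zero hs'.ne' (by exact_mod_cast h2)
    · rw [h2, Int.cast_zero, mul_zero, add_zero]
      exact mul_ne_zero hs.ne' (by exact_mod_cast h1)
  have htv : crossZ t v = -1 := by rw [crossZ_comm, ht]
  obtain ⟨F, hF, hFne, hFc⟩ := exists_parallelogram_window hX ht Set.univ (by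
    intro i _
    fin_cases i
    · exact hcorner (-t) v (gcd_neg hgt) hv (by rw [crossZ_neg_left, htv, neg_neg])
        (Or.inr (by simp [crossZ_neg_right, crossZ_self, ht]))
    · exact hcorner v t hv hgt ht (Or.inl (by simp [crossZ_self, ht]))
    · exact hcorner t (-v) hgt (gcd_neg hv) (by rw [crossZ_neg_right, htv, neg_neg])
        (Or.inr (by simp [crossZ_neg_right, crossZ_self, ht]))
    · exact hcorner (-v) (-t) (gcd_neg hv) (gcd_neg hgt)
        (by rw [crossZ_neg_right, crossZ_neg_left, ht, neg_neg])
        (Or.inl (by simp [crossZ_neg_right, crossZ_self, ht])))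
  have hexpt : ExpansiveRay X (toR2 t) := hexp _ (by rw [crossR_toR2, ht]; norm_num)
  have hexpt' : ExpansiveRay X (toR2 (-t)) :=
    hexp _ (by rw [crossR_toR2, crossZ_neg_right, ht]; norm_num)
  obtain ⟨r₁, hr₁, h₁⟩ := exists_slab_codes hX ht hF hFne hexpt'
    ((hFc 0 trivial).mono (by
      rintro p ⟨j, hj, hp⟩
      fin_cases j
      · exact absurd rfl hj
      · exact Or.inl hp
      · exact Or.inr (Or.inl hp)
      · exact Or.inr (Or.inr hp)) (by
      intro p hp
      simpa using hp))
    ((hFc 3 trivial).mono (by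
      rintro p ⟨j, hj, hp⟩
      fin_cases j
      · left
        simpa using hp
      · exact Or.inr (Or.inl hp)
      · exact Or.inr (Or.inr hp)
      · exact absurd rfl hj) (by
      intro p hp
      exact hp))
  obtain ⟨r₂, hr₂, h₂⟩ := exists_slab_codes (u := -v) (t := -t) hX
    (by rw [crossZ_neg_right, crossZ_neg_left, ht, neg_neg]) hF hFne (by rwa [neg_neg])
    ((hFc 2 trivial).shift hX (-(v + t)) (by
      rintro p ⟨j, hj, hp⟩
      fin_cases j
      · right; left
        convert hp using 1
        change -(v + t) + p - (-v + -t) = p - 0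
        abel
      · right; right
        convert hp using 1
        change -(v + t) + p - -t = p - v
        abel
      · exact absurd rfl hj
      · left
        convert hp using 1
        change -(v + t) + p - -v = p - t
        abel) (by
      intro p hp
      change p ∈ F at hp
      change p - -(v + t) - (v + t) ∈ F
      convert hp using 1
      abel))
    ((hFc 1 trivial).shift hX (-(v + t)) (by
      rintro p ⟨j, hj, hp⟩
      fin_cases j
      · right; right
        convert hp using 1
        change -(v + t) + p - (-v + -t) = p - 0
        abel
      · exact absurd rfl hj
      · left
        convert hp using 1
        change -(v + t) + p = p - (v + t)
        abel
      · right; left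
        convert hp using 1
        change -(v + t) + p - -v = p - t
        abel) (by
      intro p hp
      change p - -t ∈ F at hp
      change p - -(v + t) - v ∈ F
      convert hp using 1
      abel))
  have hr : 0 ≤ max r₁ r₂ := hr₁.trans (le_max_left _ _)
  refine ⟨slab v t F (max r₁ r₂), slab_finite v t hF _, hFne.mono (subset_slab v t hr),
    h₁ _ (le_max_left _ _), ?_⟩
  refine (h₂ (max r₁ r₂) (le_max_right _ _)).shift hX (max r₁ r₂ • v) ?_ ?_
  · intro p hp
    exact (slab_neg_neg _ _ _ _ _).1 hp
  · intro p hp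
    rw [Set.mem_ofPred_eq] at hp ⊢
    rw [slab_neg_neg]
    convert hp using 1
    abel

end Recoding

/-- a subshift with a finite nonempty set of nonexpansive rays, all
rational and closing, recodes to a polygonal subshift whose coding polygon (possibly
degenerate — a segment, occurring exactly when there are precisely two nonexpansive
rays) has its oriented edges positively parallel to the nonexpansive rays and
conversely. -/
theorem statement16 {A : Type} [Fintype A] [Nonempty A] (X : Set (Config A))
    (hX : IsSubshift X) (D : Finset Z2) (hDne : D.Nonempty)
    (hD : NonexpansiveDirSet X D) (hcl : ∀ v ∈ D, ClosingRay X v) :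
    ∃ (A' : Type) (_ : Fintype A') (Y : Set (Config A')),
      IsSubshift Y ∧ IsRecoding X Y ∧
      ((D.card = 2 ∧ ∃ w₀ w₁ : Z2, w₀ ≠ w₁ ∧
          CodesZ Y (segZ w₀ w₁ \ {w₀}) {w₀} ∧
          CodesZ Y (segZ w₀ w₁ \ {w₁}) {w₁} ∧
          (∀ e ∈ ({w₁ - w₀, w₀ - w₁} : Set Z2), ∃ v ∈ D, SameRay ℝ (toR2 e) (toR2 v)) ∧
          (∀ v ∈ D, ∃ e ∈ ({w₁ - w₀, w₀ - w₁} : Set Z2), SameRay ℝ (toR2 e) (toR2 v))) ∨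
       (D.card ≠ 2 ∧ ∃ P : IntPolygon, IsCodingPolygon Y P ∧
          (∀ i : Fin (P.n + 3), ∃ v ∈ D, SameRay ℝ (toR2 (P.edgeVec i)) (toR2 v)) ∧
          (∀ v ∈ D, ∃ i : Fin (P.n + 3), SameRay ℝ (toR2 (P.edgeVec i)) (toR2 v)))) := by
  have hbal := fun u hu h => hD.crossZ_eq_zero hX hcl (u := u) hu h
  obtain ⟨c, hc, hsum⟩ := exists_positive_weights hD.1 hbal
  have hcard := hDne.card_pos
  have hcard1 : D.card ≠ 1 := by
    intro h1
    obtain ⟨v, rfl⟩ := Finset.card_eq_one.1 h1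
    rw [Finset.sum_singleton, smul_eq_zero] at hsum
    have hv := Finset.mem_singleton_self v
    rcases hsum with h2 | h2
    · exact (hc v hv).ne' h2
    · exact ne_zero_of_gcd (hD.1 v hv) h2
  by_cases hcard2 : D.card = 2
  · obtain ⟨v, w, hvw, rfl⟩ := Finset.card_eq_two.1 hcard2
    have hv : v ∈ ({v, w} : Finset Z2) := by simp
    have hw : w ∈ ({v, w} : Finset Z2) := by simp
    have hv0 := ne_zero_of_gcd (hD.1 v hv)
    have hcross : crossZ v w = 0 := by
      rw [Finset.sum_pair hvw] at hsum
      have h1 := congrArg (crossZ v) hsum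
      rw [crossZ_add_right, crossZ_smul_right, crossZ_smul_right, crossZ_self, mul_zero, zero_add,
        crossZ_zero_right] at h1
      exact (mul_eq_zero.1 h1).resolve_left (hc w hw).ne'
    obtain rfl : w = -v :=
      (eq_or_eq_neg_of_crossZ_eq_zero (hD.1 v hv) (hD.1 w hw) hcross).resolve_left hvw.symm
    obtain ⟨G, hG, hGne, hG1, hG2⟩ := exists_segment_window hX hD hcl (hD.1 v hv) (by
      intro w hw
      rcases Finset.mem_insert.1 hw with rfl | hw
      · exact crossZ_self w
      · rw [Finset.mem_singleton.1 hw, crossZ_neg_right, crossZ_self, neg_zero])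
    obtain ⟨A', hA', Y, hY, hXY, hcode⟩ := exists_recoding hX hG hGne
    refine ⟨A', hA', Y, hY, hXY, Or.inl ⟨hcard2, 0, v, hv0.symm, ?_, ?_, ?_, ?_⟩⟩
    · refine (hcode {v} {0} (hG1.shift hX v ?_ ?_)).mono ?_ subset_rfl
      · intro p hp
        exact ⟨v, rfl, by rwa [add_sub_cancel_left]⟩
      · rintro p ⟨s, rfl, hs⟩
        rw [Set.mem_ofPred_eq, sub_add_cancel]
        rwa [sub_zero] at hs
      · rintro p rfl
        exact ⟨⟨1, zero_le_one, le_rfl, by simp⟩, hv0⟩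
    · refine (hcode {0} {v} (hG2.mono ?_ ?_)).mono ?_ subset_rfl
      · intro p hp
        exact ⟨0, rfl, by rwa [sub_zero]⟩
      · rintro p ⟨s, rfl, hs⟩
        exact hs
      · rintro p rfl
        exact ⟨⟨0, le_rfl, zero_le_one, by simp⟩, hv0.symm⟩
    · rintro e (rfl | rfl)
      · exact ⟨v, hv, by rw [sub_zero]⟩
      · exact ⟨-v, hw, by rw [zero_sub]⟩
    · intro w hw
      rcases Finset.mem_insert.1 hw with rfl | hw
      · exact ⟨w - 0, Or.inl rfl, by rw [sub_zero]⟩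
      · exact ⟨0 - v, Or.inr rfl, by rw [Finset.mem_singleton.1 hw, zero_sub]⟩
  · obtain ⟨P, v, m, hP, hv⟩ := exists_polygon hD.1 (N := D.card - 3) (by omega) hc hsum
    obtain ⟨A', hA', Y, hY, hXY, hcode⟩ := exists_recoding_polygon hX hD hcl hP hv
    have hray : ∀ i, SameRay ℝ (toR2 (P.edgeVec i)) (toR2 (v i)) := by
      intro i
      rw [(hP i).2, toR2_smul]
      exact SameRay.sameRay_nonneg_smul_left _ (by exact_mod_cast (hP i).1.le)
    refine ⟨A', hA', Y, hY, hXY, Or.inr ⟨hcard2, P, hcode, fun i => ⟨v i, ?_, hray i⟩, ?_⟩⟩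
    · exact Finset.mem_coe.1 (hv ▸ Set.mem_range_self i)
    · intro w hw
      obtain ⟨i, rfl⟩ : w ∈ Set.range v := by rwa [hv]
      exact ⟨i, hray i⟩

end PolygonalShifts
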